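/- arXiv:1708.07054 — 2 statements merged into one kernel-verified Lean document; each statement's English description precedes it below -/
import Mathlib

section
/- Let I_n be the domino ideal of the 2×n rectangle. Then the projective dimension of I_n equals n − 1 for all n ≥ 1. -/
/-- The vertical domino occupying column `k` (0-indexed) of a 2×n board. -/
def Vert (k : ℕ) : Finset (ℕ × ℕ) := {(0, k), (1, k)}

/-- The horizontal domino in row `i` covering columns `k` and `k+1`. -/
def Horiz (i k : ℕ) : Finset (ℕ × ℕ) := {(i, k), (i, k + 1)}

/-- A domino on the 2×n board. -/
def IsDomino (n : ℕ) (d : Finset (ℕ × ℕ)) : Prop :=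
  (∃ k < n, d = Vert k) ∨ (∃ i < 2, ∃ k, k + 1 < n ∧ d = Horiz i k)

/-- `T` is a domino tiling of the 2×n board: a set of dominoes, pairwise disjoint,
covering exactly the cells of the board. -/
def IsTiling (n : ℕ) (T : Finset (Finset (ℕ × ℕ))) : Prop :=
  (∀ d ∈ T, IsDomino n d) ∧
  (∀ c : ℕ × ℕ, (c.1 < 2 ∧ c.2 < n) ↔ ∃ d ∈ T, c ∈ d) ∧
  (∀ d ∈ T, ∀ e ∈ T, d ≠ e → Disjoint d e)

/-- `T_n`, the set of all domino tilings of the 2×n rectangle. -/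
def Tilings (n : ℕ) : Set (Finset (Finset (ℕ × ℕ))) := {T | IsTiling n T}

open scoped Classical

/-- The variable (in the paper's 1-indexed labelling) attached to a domino of the 2×n board:
the vertical domino in column k (1-indexed) ↦ y_k = `Sum.inr k`, the top horizontal domino
starting in column k ↦ x_k = `Sum.inl k`, the bottom one ↦ x_{n-1+k} = `Sum.inl (n-1+k)`. -/
noncomputable def dominoVar (n : ℕ) (d : Finset (ℕ × ℕ)) : ℕ ⊕ ℕ :=
  if h : ∃ k, d = Vert k then Sum.inr (h.choose + 1)
  else if h2 : ∃ k, d = Horiz 0 k then Sum.inl (h2.choose + 1)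
  else if h3 : ∃ k, d = Horiz 1 k then Sum.inl (n + h3.choose)
  else Sum.inl 0

/-- The squarefree monomial (in `K[x_1,…,x_{2n-2},y_1,…,y_n]`, realized as
`MvPolynomial (ℕ ⊕ ℕ) K` with x_i = `X (Sum.inl i)` and y_i = `X (Sum.inr i)`)
associated to a tiling `T`, using the labelling of the 2×n board. -/
noncomputable def dominoMonomial (K : Type*) [Field K] (n : ℕ)
    (T : Finset (Finset (ℕ × ℕ))) : MvPolynomial (ℕ ⊕ ℕ) K :=
  ∏ d ∈ T, MvPolynomial.X (dominoVar n d)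

/-- The ideal generated by the tiling monomials of all tilings of a 2×m rectangle,
labelled as dominoes of the ambient 2×n board. -/
noncomputable def dominoIdealIn (K : Type*) [Field K] (n m : ℕ) :
    Ideal (MvPolynomial (ℕ ⊕ ℕ) K) :=
  Ideal.span {p | ∃ T, IsTiling m T ∧ p = dominoMonomial K n T}

/-- The domino ideal `I_n`. -/
noncomputable def dominoIdeal (K : Type*) [Field K] (n : ℕ) :
    Ideal (MvPolynomial (ℕ ⊕ ℕ) K) := dominoIdealIn K n n

/-- `V_n`: the ideal generated by the tilings containing the vertical domino `y_n`. -/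
noncomputable def Vn (K : Type*) [Field K] (n : ℕ) : Ideal (MvPolynomial (ℕ ⊕ ℕ) K) :=
  Ideal.span {p | ∃ T, IsTiling n T ∧ Vert (n - 1) ∈ T ∧ p = dominoMonomial K n T}

/-- `U_n`: the ideal generated by the tilings containing the two rightmost horizontal
dominoes `x_{n-1}` and `x_{2n-2}`. -/
noncomputable def Un (K : Type*) [Field K] (n : ℕ) : Ideal (MvPolynomial (ℕ ⊕ ℕ) K) :=
  Ideal.span {p | ∃ T, IsTiling n T ∧ Horiz 0 (n - 2) ∈ T ∧ Horiz 1 (n - 2) ∈ T ∧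
    p = dominoMonomial K n T}

/-- The set of (exponent vectors of) minimal monomial generators of a monomial ideal:
monomials of the ideal not strictly divisible by any other monomial of the ideal. -/
def minGens {K : Type*} [Field K] {σ : Type*} (I : Ideal (MvPolynomial σ K)) :
    Set (σ →₀ ℕ) :=
  {a | MvPolynomial.monomial a (1 : K) ∈ I ∧
      ∀ b : σ →₀ ℕ, b ≤ a → MvPolynomial.monomial b (1 : K) ∈ I → b = a}


/-- A minimal graded free resolution of an ideal `I` in a polynomial ring
`R = MvPolynomial σ K`:
`0 → F_len → ⋯ → F_1 → F_0 → I → 0`, where `F_i = ⊕_j R(-j)^{β i j}` is realized as the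
free module on the generator set `Σ j, Fin (β i j)` (a generator `⟨j, m⟩` has degree `j`).
The fields record homogeneity of the maps (entries of the matrices of `d` are homogeneous
of the appropriate degrees), minimality (all entries lie in the irrelevant maximal ideal,
i.e. every entry from a degree-`j` generator to a degree-`j'` generator with `j ≤ j'`
vanishes), exactness, surjectivity onto `I`, and that `len` is the length.
`β i j` is the (i,j)-th graded Betti number of `I`. -/
structure MinimalFreeResolution {K : Type*} [Field K] {σ : Type*}
    (I : Ideal (MvPolynomial σ K)) where
  β : ℕ → ℕ → ℕ
  len : ℕ
  d : ∀ i : ℕ, ((Σ j : ℕ, Fin (β (i + 1) j)) →₀ MvPolynomial σ K)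
      →ₗ[MvPolynomial σ K] ((Σ j : ℕ, Fin (β i j)) →₀ MvPolynomial σ K)
  ε : ((Σ j : ℕ, Fin (β 0 j)) →₀ MvPolynomial σ K) →ₗ[MvPolynomial σ K] MvPolynomial σ K
  ε_homog : ∀ g : Σ j : ℕ, Fin (β 0 j),
    ε (Finsupp.single g 1) ∈ MvPolynomial.homogeneousSubmodule σ K g.1
  ε_range : LinearMap.range ε = I
  d_homog : ∀ (i : ℕ) (g : Σ j : ℕ, Fin (β (i + 1) j)) (g' : Σ j : ℕ, Fin (β i j)),
    (d i (Finsupp.single g 1)) g' ∈ MvPolynomial.homogeneousSubmodule σ K (g.1 - g'.1)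
  d_minimal : ∀ (i : ℕ) (g : Σ j : ℕ, Fin (β (i + 1) j)) (g' : Σ j : ℕ, Fin (β i j)),
    g.1 ≤ g'.1 → (d i (Finsupp.single g 1)) g' = 0
  exact_at_zero : LinearMap.ker ε = LinearMap.range (d 0)
  exact : ∀ i : ℕ, LinearMap.ker (d i) = LinearMap.range (d (i + 1))
  len_spec : ∀ i j : ℕ, len < i → β i j = 0
  len_min : len = 0 ∨ ∃ j, β len j ≠ 0

section Homological

open CategoryTheory Abelian

universe u

variable {R : Type u} [CommRing R]

/-- The module `M` has projective dimension `< n`. -/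
abbrev PdLT (R : Type u) [CommRing R] (M : Type u) [AddCommGroup M] [Module R M] (n : ℕ) : Prop :=
  HasProjectiveDimensionLT (ModuleCat.of R M) n

lemma PdLT.mono {M : Type u} [AddCommGroup M] [Module R M] {m n : ℕ} (h : PdLT R M m)
    (hmn : m ≤ n) : PdLT R M n :=
  haveI := h
  hasProjectiveDimensionLT_of_ge _ m n hmn

lemma pdLT_one_iff {M : Type u} [AddCommGroup M] [Module R M] :
    PdLT R M 1 ↔ Module.Projective R M := by
  rw [PdLT, ← projective_iff_hasProjectiveDimensionLT_one, IsProjective.iff_projective]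

lemma PdLT.prod {M N : Type u} [AddCommGroup M] [Module R M] [AddCommGroup N] [Module R N]
    {n : ℕ} (hM : PdLT R M n) (hN : PdLT R N n) : PdLT R (M × N) n :=
  haveI := hM
  haveI := hN
  hasProjectiveDimensionLT_of_iso
    (ModuleCat.biprodIsoProd (ModuleCat.of R M) (ModuleCat.of R N)) n

/-- The map `c ↦ (z c, -y c)` from `P ⊓ Q` to `P × Q`. -/
def syzygyInclusion (y z : R) (P Q : Ideal R) : ↥(P ⊓ Q) →ₗ[R] P × Q :=
  z • (LinearMap.inl R P Q ∘ₗ Submodule.inclusion inf_le_left) +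
    y • (LinearMap.inr R P Q ∘ₗ (-Submodule.inclusion inf_le_right))

/-- The map `(p, q) ↦ y p + z q` from `P × Q` to an ideal `S` containing its values. -/
def combinationMap (y z : R) (P Q S : Ideal R) (hS : ∀ p ∈ P, ∀ q ∈ Q, y * p + z * q ∈ S) :
    (P × Q) →ₗ[R] S :=
  LinearMap.codRestrict S ((y • P.subtype).coprod (z • Q.subtype)) fun x ↦ by
    simpa using hS x.1 x.1.2 x.2 x.2.2

variable {y z : R} {P Q S : Ideal R}

/-- The data making `0 → P ⊓ Q → P × Q → S → 0` exact, where `S = y P + z Q`. -/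
structure IsCoprimeSum (y z : R) (P Q S : Ideal R) : Prop where
  mem_iff : ∀ f, f ∈ S ↔ ∃ p ∈ P, ∃ q ∈ Q, y * p + z * q = f
  left_ne_zero : y ≠ 0
  right_ne_zero : z ≠ 0
  dvd_of_mul_eq : ∀ a b, y * a = z * b → y ∣ b
  mem_of_left_mul_mem : ∀ c, y * c ∈ Q → c ∈ Q
  mem_of_right_mul_mem : ∀ c, z * c ∈ P → c ∈ P

namespace IsCoprimeSum

lemma combination_mem (h : IsCoprimeSum y z P Q S) (p : R) (hp : p ∈ P) (q : R) (hq : q ∈ Q) :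
    y * p + z * q ∈ S :=
  (h.mem_iff _).2 ⟨p, hp, q, hq, rfl⟩

lemma surjective (h : IsCoprimeSum y z P Q S) :
    Function.Surjective (combinationMap y z P Q S h.combination_mem) := by
  rintro ⟨f, hf⟩
  obtain ⟨p, hp, q, hq, rfl⟩ := (h.mem_iff f).1 hf
  exact ⟨(⟨p, hp⟩, ⟨q, hq⟩), Subtype.ext (by simp [combinationMap])⟩

variable [IsDomain R]

lemma exact (h : IsCoprimeSum y z P Q S) :
    Function.Exact (syzygyInclusion y z P Q) (combinationMap y z P Q S h.combination_mem) := by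
  rintro ⟨⟨p, hp⟩, ⟨q, hq⟩⟩
  constructor
  · intro hpq
    have hpq' : y * p + z * q = 0 := congrArg Subtype.val hpq
    obtain ⟨c, hc⟩ := h.dvd_of_mul_eq p (-q) (by linear_combination hpq')
    have hp' : p = z * c :=
      mul_left_cancel₀ h.left_ne_zero (by linear_combination hpq' + z * hc)
    have hcP : c ∈ P := h.mem_of_right_mul_mem c (hp' ▸ hp)
    have hcQ : c ∈ Q := h.mem_of_left_mul_mem c (hc ▸ Q.neg_mem hq)
    refine ⟨⟨c, hcP, hcQ⟩, ?_⟩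
    have hq' : q = -(y * c) := by linear_combination -hc
    ext <;> simp [syzygyInclusion, hp', hq']
  · rintro ⟨⟨c, hcP, hcQ⟩, hc⟩
    rw [← hc]
    apply Subtype.ext
    simp [syzygyInclusion, combinationMap, mul_left_comm]

lemma injective (h : IsCoprimeSum y z P Q S) : Function.Injective (syzygyInclusion y z P Q) := by
  rw [injective_iff_map_eq_zero]
  rintro ⟨c, hcP, hcQ⟩ hc
  have : z * c = 0 := by
    simpa [syzygyInclusion] using congrArg (fun x : P × Q ↦ (x.1 : R)) hc
  exact Subtype.ext ((mul_eq_zero.1 this).resolve_left h.right_ne_zero)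

lemma shortExact (h : IsCoprimeSum y z P Q S) :
    (ShortComplex.moduleCatMk _ _ h.exact.linearMap_comp_eq_zero).ShortExact :=
  ModuleCat.shortComplex_shortExact _ h.exact h.injective h.surjective

lemma pdLT_succ (h : IsCoprimeSum y z P Q S) {n : ℕ} (hP : PdLT R P (n + 1))
    (hQ : PdLT R Q (n + 1)) (hPQ : PdLT R ↥(P ⊓ Q) n) : PdLT R S (n + 1) :=
  h.shortExact.hasProjectiveDimensionLT_X₃ n hPQ (hP.prod hQ)

lemma exists_ext_ne_zero (h : IsCoprimeSum y z P Q S) {N : Type u} [AddCommGroup N] [Module R N]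
    (hy : ∀ x : N, y • x = 0) (hz : ∀ x : N, z • x = 0) {n : ℕ}
    (hn : ∃ e : Ext (ModuleCat.of R ↥(P ⊓ Q)) (ModuleCat.of R N) n, e ≠ 0) :
    ∃ e : Ext (ModuleCat.of R S) (ModuleCat.of R N) (n + 1), e ≠ 0 := by
  obtain ⟨e, he⟩ := hn
  have smul_eq_zero' : ∀ r : R, (∀ x : N, r • x = 0) → ∀ {M : ModuleCat.{u} R}
      (a : Ext M (ModuleCat.of R N) n), r • a = 0 := by
    intro r hr M a
    have h0 : r • 𝟙 (ModuleCat.of R N) = 0 := by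
      ext x
      exact hr x
    rw [Ext.smul_eq_comp_mk₀, h0, Ext.mk₀_zero, Ext.comp_zero]
  refine ⟨h.shortExact.extClass.comp e (add_comm 1 n), fun h0 ↦ he ?_⟩
  obtain ⟨x, hx⟩ : ∃ x : Ext (ModuleCat.of R (P × Q)) (ModuleCat.of R N) n,
      (Ext.mk₀ (ModuleCat.ofHom (syzygyInclusion y z P Q))).comp x (zero_add n) = e :=
    Ext.contravariant_sequence_exact₁ h.shortExact _ e (add_comm 1 n) h0
  have hf : ModuleCat.ofHom (syzygyInclusion y z P Q) =
      z • ModuleCat.ofHom (LinearMap.inl R P Q ∘ₗ Submodule.inclusion inf_le_left) +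
      y • ModuleCat.ofHom (LinearMap.inr R P Q ∘ₗ (-Submodule.inclusion inf_le_right)) := rfl
  rw [← hx, hf, Ext.mk₀_add, Ext.mk₀_smul, Ext.mk₀_smul, Ext.add_comp, Ext.smul_comp,
    Ext.smul_comp, smul_eq_zero' z hz, smul_eq_zero' y hy, add_zero]

end IsCoprimeSum

end Homological

section Recursion

open CategoryTheory Abelian

universe u

variable {R : Type u} [CommRing R]

lemma smul_quotient_eq_zero {I : Ideal R} {r : R} (hr : r ∈ I) (x : R ⧸ I) : r • x = 0 := by
  obtain ⟨x, rfl⟩ := Ideal.Quotient.mk_surjective x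
  exact Ideal.Quotient.eq_zero_iff_mem.2 (I.mul_mem_right x hr)

/-- Up to index `N`, the ideals `A m` satisfy `A (m + 2) = y (m + 1) A (m + 1) + z m A m` with
multipliers that are regular modulo the ideals involved. -/
structure IsCoprimeRecursion (N : ℕ) (y z : ℕ → R) (A : ℕ → Ideal R) : Prop where
  zero : A 0 = ⊤
  one : A 1 = Ideal.span {y 0}
  mem_iff : ∀ m f, f ∈ A (m + 2) ↔ ∃ p ∈ A (m + 1), ∃ q ∈ A m, y (m + 1) * p + z m * q = f
  y_ne_zero : ∀ m, y m ≠ 0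
  z_ne_zero : ∀ m, z m ≠ 0
  dvd_of_mul_eq : ∀ m a b, y (m + 1) * a = z m * b → y (m + 1) ∣ b
  mem_of_y_mul_mem : ∀ k m c, k ≤ m → y m * c ∈ A k → c ∈ A k
  mem_of_z_mul_mem : ∀ m c, m + 2 ≤ N → z m * c ∈ A (m + 1) → c ∈ A (m + 1)

namespace IsCoprimeRecursion

variable {N : ℕ} {y z : ℕ → R} {A : ℕ → Ideal R}

lemma isCoprimeSum (h : IsCoprimeRecursion N y z A) {m : ℕ} (hm : m + 2 ≤ N) :
    IsCoprimeSum (y (m + 1)) (z m) (A (m + 1)) (A m) (A (m + 2)) where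
  mem_iff := h.mem_iff m
  left_ne_zero := h.y_ne_zero _
  right_ne_zero := h.z_ne_zero _
  dvd_of_mul_eq := h.dvd_of_mul_eq m
  mem_of_left_mul_mem c := h.mem_of_y_mul_mem m (m + 1) c (by omega)
  mem_of_right_mul_mem c := h.mem_of_z_mul_mem m c hm

lemma isCoprimeSum_inf (h : IsCoprimeRecursion N y z A) {m : ℕ} (hm : m + 2 ≤ N) :
    IsCoprimeSum (y (m + 1)) (z m) (A (m + 1)) (A (m + 1) ⊓ A m) (A (m + 2) ⊓ A (m + 1)) where
  mem_iff f := by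
    constructor
    · rintro ⟨hf, hf'⟩
      obtain ⟨p, hp, q, hq, rfl⟩ := (h.mem_iff m f).1 hf
      refine ⟨p, hp, q, ⟨h.mem_of_z_mul_mem m q hm ?_, hq⟩, rfl⟩
      exact ((A (m + 1)).add_mem_iff_right (Ideal.mul_mem_left _ _ hp)).1 hf'
    · rintro ⟨p, hp, q, ⟨hq', hq⟩, rfl⟩
      exact ⟨(h.mem_iff m _).2 ⟨p, hp, q, hq, rfl⟩,
        add_mem (Ideal.mul_mem_left _ _ hp) (Ideal.mul_mem_left _ _ hq')⟩
  left_ne_zero := h.y_ne_zero _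
  right_ne_zero := h.z_ne_zero _
  dvd_of_mul_eq := h.dvd_of_mul_eq m
  mem_of_left_mul_mem c hc := ⟨h.mem_of_y_mul_mem (m + 1) (m + 1) c le_rfl hc.1,
    h.mem_of_y_mul_mem m (m + 1) c (by omega) hc.2⟩
  mem_of_right_mul_mem c := h.mem_of_z_mul_mem m c hm

variable [IsDomain R]

lemma pdLT_aux (h : IsCoprimeRecursion N y z A) (m : ℕ) (hm : m + 1 ≤ N) :
    PdLT R (A m) (m + 1) ∧ PdLT R (A (m + 1)) (m + 1) ∧ PdLT R ↥(A (m + 1) ⊓ A m) (m + 1) := by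
  induction m with
  | zero =>
    have h0 : PdLT R (⊤ : Ideal R) 1 :=
      pdLT_one_iff.2 (Module.Projective.of_equiv Submodule.topEquiv.symm)
    have h1 : PdLT R (Ideal.span {y 0}) 1 := pdLT_one_iff.2
      (Module.Projective.of_equiv (LinearEquiv.toSpanNonzeroSingleton R R _ (h.y_ne_zero 0)))
    rw [h.zero, h.one, inf_top_eq]
    exact ⟨h0, h1, h1⟩
  | succ m ih =>
    obtain ⟨ih₀, ih₁, ih₂⟩ := ih (by omega)
    refine ⟨ih₁.mono (by omega), ?_, ?_⟩
    · exact (h.isCoprimeSum hm).pdLT_succ (ih₁.mono (by omega)) (ih₀.mono (by omega)) ih₂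
    · exact (h.isCoprimeSum_inf hm).pdLT_succ (ih₁.mono (by omega)) (ih₂.mono (by omega))
        (by rwa [← inf_assoc, inf_idem])

lemma pdLT (h : IsCoprimeRecursion N y z A) (m : ℕ) (hm : m + 1 ≤ N) :
    PdLT R (A (m + 1)) (m + 1) :=
  (h.pdLT_aux m hm).2.1

lemma exists_ext_inf_ne_zero (h : IsCoprimeRecursion N y z A) {I : Ideal R} (hI : I ≠ ⊤)
    (hy : ∀ m, y m ∈ I) (hz : ∀ m, z m ∈ I) (m : ℕ) (hm : m + 1 ≤ N) :
    ∃ e : Ext (ModuleCat.of R ↥(A (m + 1) ⊓ A m)) (ModuleCat.of R (R ⧸ I)) m, e ≠ 0 := by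
  induction m with
  | zero =>
    rw [h.zero, h.one, inf_top_eq]
    let e := LinearEquiv.toSpanNonzeroSingleton R R _ (h.y_ne_zero 0)
    let f : Ideal.span {y 0} →ₗ[R] R ⧸ I := I.mkQ ∘ₗ e.symm.toLinearMap
    refine ⟨Ext.mk₀ (ModuleCat.ofHom f), fun h0 ↦ hI ?_⟩
    rw [Ext.mk₀_eq_zero_iff] at h0
    have hf : f (e 1) = 0 := congrArg (fun g ↦ g.hom (e 1)) h0
    exact (Ideal.eq_top_iff_one I).2 (Ideal.Quotient.eq_zero_iff_mem.1 (by simpa [f] using hf))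
  | succ m ih =>
    refine (h.isCoprimeSum_inf hm).exists_ext_ne_zero (smul_quotient_eq_zero (hy _))
      (smul_quotient_eq_zero (hz _)) ?_
    rw [← inf_assoc, inf_idem]
    exact ih (by omega)

lemma not_pdLT (h : IsCoprimeRecursion N y z A) {I : Ideal R} (hI : I ≠ ⊤)
    (hy : ∀ m, y m ∈ I) (hz : ∀ m, z m ∈ I) (m : ℕ) (hm : m + 1 ≤ N) :
    ¬ PdLT R (A (m + 1)) m := by
  intro hpd
  obtain ⟨e, he⟩ :
      ∃ e : Ext (ModuleCat.of R (A (m + 1))) (ModuleCat.of R (R ⧸ I)) m, e ≠ 0 := by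
    cases m with
    | zero =>
      have := h.exists_ext_inf_ne_zero hI hy hz 0 hm
      rwa [h.zero, inf_top_eq] at this
    | succ m =>
      exact (h.isCoprimeSum hm).exists_ext_ne_zero (smul_quotient_eq_zero (hy _))
        (smul_quotient_eq_zero (hz _)) (h.exists_ext_inf_ne_zero hI hy hz m (by omega))
  exact he (e.eq_zero_of_hasProjectiveDimensionLT m le_rfl)

end IsCoprimeRecursion

end Recursion

section Resolution

universe u v

lemma pdLT_range_iff {R : Type u} [CommRing R] {M N : Type u} [AddCommGroup M] [Module R M]
    [AddCommGroup N] [Module R N] [Module.Projective R M] (f : M →ₗ[R] N) (n : ℕ) :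
    PdLT R (LinearMap.range f) (n + 2) ↔ PdLT R (LinearMap.ker f) (n + 1) := by
  rw [← LinearMap.ker_rangeRestrict f]
  exact (LinearMap.shortExact_shortComplexKer
    f.surjective_rangeRestrict).hasProjectiveDimensionLT_X₃_iff n
    ((IsProjective.iff_projective M).1 inferInstance)

lemma pdLT_range_of_ker_eq_bot {R : Type u} [CommRing R] {M N : Type u} [AddCommGroup M]
    [Module R M] [AddCommGroup N] [Module R N] [Module.Projective R M] (f : M →ₗ[R] N)
    (hf : LinearMap.ker f = ⊥) : PdLT R (LinearMap.range f) 1 :=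
  pdLT_one_iff.2 (Module.Projective.of_equiv (LinearEquiv.ofInjective f (LinearMap.ker_eq_bot.1 hf)))

/-- If a free module surjects onto a projective module with kernel inside `I` times the free
module, where the powers of `I` intersect trivially, then the kernel vanishes. -/
lemma ker_eq_bot_of_projective_range {R : Type*} [CommRing R] {ι N : Type*} [AddCommGroup N]
    [Module R N] (f : (ι →₀ R) →ₗ[R] N) [Module.Projective R (LinearMap.range f)] (I : Ideal R)
    (hI : ⨅ k : ℕ, I ^ k = ⊥) (hf : ∀ x ∈ LinearMap.ker f, ∀ g, x g ∈ I) :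
    LinearMap.ker f = ⊥ := by
  obtain ⟨s, hs⟩ := f.rangeRestrict.exists_rightInverse_of_surjective f.range_rangeRestrict
  let p : (ι →₀ R) →ₗ[R] (ι →₀ R) := LinearMap.id - s ∘ₗ f.rangeRestrict
  have hp_ker : ∀ x, p x ∈ LinearMap.ker f := by
    intro x
    rw [← LinearMap.ker_rangeRestrict f, LinearMap.mem_ker]
    have := LinearMap.congr_fun hs (f.rangeRestrict x)
    simp only [LinearMap.comp_apply, LinearMap.id_apply] at this
    simp [p, this]
  have hp_id : ∀ x ∈ LinearMap.ker f, p x = x := by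
    intro x hx
    rw [← LinearMap.ker_rangeRestrict f, LinearMap.mem_ker] at hx
    simp [p, hx]
  have hp_pow : ∀ (k : ℕ) x, (∀ g, x g ∈ I ^ k) → ∀ g, p x g ∈ I ^ (k + 1) := by
    intro k x hx g
    rw [← Finsupp.sum_single x, map_finsuppSum, Finsupp.sum, Finsupp.finsetSum_apply]
    refine Ideal.sum_mem _ fun i _ ↦ ?_
    rw [← mul_one (x i), ← smul_eq_mul, ← Finsupp.smul_single, map_smul, Finsupp.smul_apply,
      smul_eq_mul, pow_succ]
    exact Ideal.mul_mem_mul (hx i) (hf _ (hp_ker _) g)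
  have key : ∀ (k : ℕ), ∀ x ∈ LinearMap.ker f, ∀ g, x g ∈ I ^ k := by
    intro k
    induction k with
    | zero => simp
    | succ k ih =>
      intro x hx g
      rw [← hp_id x hx]
      exact hp_pow k x (ih x hx) g
  rw [eq_bot_iff]
  intro x hx
  ext g
  have : x g ∈ ⨅ k : ℕ, I ^ k := (Submodule.mem_iInf _).2 fun k ↦ key k x hx g
  rw [hI] at this
  simpa using this

lemma iInf_pow_idealOfVars_eq_bot (σ R : Type*) [CommRing R] :
    ⨅ k : ℕ, MvPolynomial.idealOfVars σ R ^ k = ⊥ := by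
  rw [eq_bot_iff]
  intro p hp
  rw [Submodule.mem_iInf] at hp
  ext d
  rw [MvPolynomial.coeff_zero]
  exact (MvPolynomial.mem_pow_idealOfVars_iff' _ _).1 (hp (d.degree + 1)) d (by omega)

lemma one_notMem_idealOfVars (σ R : Type*) [CommRing R] [Nontrivial R] :
    (1 : MvPolynomial σ R) ∉ MvPolynomial.idealOfVars σ R := by
  intro h
  rw [← pow_one (MvPolynomial.idealOfVars σ R)] at h
  simpa using (MvPolynomial.mem_pow_idealOfVars_iff' _ _).1 h 0 (by simp)

lemma MvPolynomial.IsHomogeneous.mem_idealOfVars {σ R : Type*} [CommRing R]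
    {p : MvPolynomial σ R} {n : ℕ} (hp : p.IsHomogeneous n) (hn : n ≠ 0) :
    p ∈ MvPolynomial.idealOfVars σ R := by
  rw [← pow_one (MvPolynomial.idealOfVars σ R), MvPolynomial.mem_pow_idealOfVars_iff']
  intro d hd
  exact hp.coeff_eq_zero (by omega)

namespace MinimalFreeResolution

open MvPolynomial

variable {K : Type u} [Field K] {σ : Type v} {I : Ideal (MvPolynomial σ K)}
  (F : MinimalFreeResolution I)

lemma d_apply_mem (i : ℕ) (x : (Σ j : ℕ, Fin (F.β (i + 1) j)) →₀ MvPolynomial σ K)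
    (g : Σ j : ℕ, Fin (F.β i j)) : F.d i x g ∈ idealOfVars σ K := by
  rw [← Finsupp.sum_single x, map_finsuppSum, Finsupp.sum, Finsupp.finsetSum_apply]
  refine Ideal.sum_mem _ fun h _ ↦ ?_
  rw [← mul_one (x h), ← smul_eq_mul, ← Finsupp.smul_single, map_smul, Finsupp.smul_apply,
    smul_eq_mul]
  refine Ideal.mul_mem_left _ _ ?_
  by_cases hle : h.1 ≤ g.1
  · rw [F.d_minimal i h g hle]
    exact zero_mem _
  · exact IsHomogeneous.mem_idealOfVars (F.d_homog i h g) (by omega)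

lemma betti_eq_zero_of_range_eq_bot {i : ℕ} (h : LinearMap.range (F.d i) = ⊥) (j : ℕ) :
    F.β (i + 1) j = 0 := by
  by_contra hj
  let g : Σ j : ℕ, Fin (F.β (i + 1) j) := ⟨j, ⟨0, Nat.pos_of_ne_zero hj⟩⟩
  have hg : Finsupp.single g (1 : MvPolynomial σ K) ∈ LinearMap.range (F.d (i + 1)) := by
    rw [← F.exact i, LinearMap.range_eq_bot.1 h, LinearMap.ker_zero]
    exact Submodule.mem_top
  obtain ⟨x, hx⟩ := hg
  have := F.d_apply_mem (i + 1) x g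
  rw [hx, Finsupp.single_eq_same] at this
  exact one_notMem_idealOfVars σ K this

lemma pdLT_iff_range (i n : ℕ) :
    PdLT (MvPolynomial σ K) I (n + i + 2) ↔
      PdLT (MvPolynomial σ K) (LinearMap.range (F.d i)) (n + 1) := by
  induction i generalizing n with
  | zero =>
    rw [← F.exact_at_zero, ← pdLT_range_iff, F.ε_range]
  | succ i ih =>
    rw [← F.exact i, ← pdLT_range_iff, ← ih (n + 1)]
    ring_nf

lemma pdLT_len : PdLT (MvPolynomial σ K) I (F.len + 1) := by
  have hempty : IsEmpty (Σ j : ℕ, Fin (F.β (F.len + 1) j)) := by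
    rw [isEmpty_sigma]
    intro j
    rw [F.len_spec (F.len + 1) j (by omega)]
    infer_instance
  have hd : LinearMap.range (F.d F.len) = ⊥ := by
    rw [LinearMap.range_eq_bot]
    exact Subsingleton.elim _ _
  generalize F.len = L at hd
  cases L with
  | zero =>
    have := pdLT_range_of_ker_eq_bot F.ε (F.exact_at_zero.trans hd)
    rwa [F.ε_range] at this
  | succ l =>
    have := (F.pdLT_iff_range l 0).2
      (pdLT_range_of_ker_eq_bot (F.d l) ((F.exact l).trans hd))
    rwa [zero_add] at this

lemma len_le_of_pdLT {n : ℕ} (h : PdLT (MvPolynomial σ K) I (n + 1)) : F.len ≤ n := by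
  by_contra! hlt
  obtain ⟨i, hi⟩ : ∃ i, F.len = i + 1 := ⟨F.len - 1, by omega⟩
  have hI : PdLT (MvPolynomial σ K) I (i + 1) := h.mono (by omega)
  have hrange : LinearMap.range (F.d i) = ⊥ := by
    cases i with
    | zero =>
      rw [← F.exact_at_zero]
      rw [← F.ε_range, zero_add, pdLT_one_iff] at hI
      refine ker_eq_bot_of_projective_range F.ε _ (iInf_pow_idealOfVars_eq_bot σ K) ?_
      rw [F.exact_at_zero]
      rintro _ ⟨x, rfl⟩ g
      exact F.d_apply_mem 0 x g
    | succ i =>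
      have hproj : PdLT (MvPolynomial σ K) (LinearMap.range (F.d i)) (0 + 1) :=
        (F.pdLT_iff_range i 0).1 (hI.mono (by omega))
      rw [zero_add, pdLT_one_iff] at hproj
      rw [← F.exact i]
      refine ker_eq_bot_of_projective_range (F.d i) _ (iInf_pow_idealOfVars_eq_bot σ K) ?_
      rw [F.exact i]
      rintro _ ⟨x, rfl⟩ g
      exact F.d_apply_mem (i + 1) x g
  obtain h0 | ⟨j, hj⟩ := F.len_min
  · omega
  · rw [hi] at hj
    exact hj (F.betti_eq_zero_of_range_eq_bot hrange j)

end MinimalFreeResolution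

end Resolution

section Tilings

lemma mem_vert {c : ℕ × ℕ} {k : ℕ} : c ∈ Vert k ↔ c.1 < 2 ∧ c.2 = k := by
  obtain ⟨i, j⟩ := c
  simp only [Vert, Finset.mem_insert, Finset.mem_singleton, Prod.mk.injEq]
  omega

lemma mem_horiz {c : ℕ × ℕ} {i k : ℕ} : c ∈ Horiz i k ↔ c.1 = i ∧ (c.2 = k ∨ c.2 = k + 1) := by
  obtain ⟨i', j⟩ := c
  simp only [Horiz, Finset.mem_insert, Finset.mem_singleton, Prod.mk.injEq]
  omega

lemma vert_injective : Function.Injective Vert := fun k l h ↦ by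
  have : ((0, k) : ℕ × ℕ) ∈ Vert l := h ▸ mem_vert.2 ⟨by simp, rfl⟩
  exact (mem_vert.1 this).2

lemma horiz_eq_iff {i j k l : ℕ} : Horiz i k = Horiz j l ↔ i = j ∧ k = l := by
  refine ⟨fun h ↦ ?_, fun ⟨hi, hk⟩ ↦ hi ▸ hk ▸ rfl⟩
  have h₁ : (i, k) ∈ Horiz j l := h ▸ mem_horiz.2 ⟨rfl, Or.inl rfl⟩
  have h₂ : (j, l) ∈ Horiz i k := h ▸ mem_horiz.2 ⟨rfl, Or.inl rfl⟩
  rw [mem_horiz] at h₁ h₂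
  simp only at h₁ h₂
  omega

lemma horiz_ne_vert (i k l : ℕ) : Horiz i k ≠ Vert l := fun h ↦ by
  have h₁ : (i, k) ∈ Vert l := h ▸ mem_horiz.2 ⟨rfl, Or.inl rfl⟩
  have h₂ : (i, k + 1) ∈ Vert l := h ▸ mem_horiz.2 ⟨rfl, Or.inr rfl⟩
  rw [mem_vert] at h₁ h₂
  simp only at h₁ h₂
  omega

lemma dominoVar_vert (n k : ℕ) : dominoVar n (Vert k) = Sum.inr (k + 1) := by
  have h : ∃ l, Vert k = Vert l := ⟨k, rfl⟩
  rw [dominoVar, dif_pos h, ← vert_injective h.choose_spec]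

lemma dominoVar_horiz_zero (n k : ℕ) : dominoVar n (Horiz 0 k) = Sum.inl (k + 1) := by
  have h : ∃ l, Horiz 0 k = Horiz 0 l := ⟨k, rfl⟩
  rw [dominoVar, dif_neg fun ⟨l, hl⟩ ↦ horiz_ne_vert _ _ _ hl, dif_pos h,
    ← (horiz_eq_iff.1 h.choose_spec).2]

lemma dominoVar_horiz_one (n k : ℕ) : dominoVar n (Horiz 1 k) = Sum.inl (n + k) := by
  have h : ∃ l, Horiz 1 k = Horiz 1 l := ⟨k, rfl⟩
  rw [dominoVar, dif_neg fun ⟨l, hl⟩ ↦ horiz_ne_vert _ _ _ hl,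
    dif_neg fun ⟨l, hl⟩ ↦ one_ne_zero (horiz_eq_iff.1 hl).1, dif_pos h,
    ← (horiz_eq_iff.1 h.choose_spec).2]

lemma IsDomino.nonempty {n : ℕ} {d : Finset (ℕ × ℕ)} (hd : IsDomino n d) : d.Nonempty := by
  rcases hd with ⟨k, -, rfl⟩ | ⟨i, -, k, -, rfl⟩
  · exact ⟨(0, k), by simp [mem_vert]⟩
  · exact ⟨(i, k), by simp [mem_horiz]⟩

lemma IsDomino.mono {m n : ℕ} (hmn : m ≤ n) {d : Finset (ℕ × ℕ)} (hd : IsDomino m d) :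
    IsDomino n d := by
  rcases hd with ⟨k, hk, rfl⟩ | ⟨i, hi, k, hk, rfl⟩
  · exact Or.inl ⟨k, hk.trans_le hmn, rfl⟩
  · exact Or.inr ⟨i, hi, k, hk.trans_le hmn, rfl⟩

lemma IsDomino.restrict {m n : ℕ} {d : Finset (ℕ × ℕ)} (hd : IsDomino n d)
    (h : ∀ c ∈ d, c.2 < m) : IsDomino m d := by
  rcases hd with ⟨k, -, rfl⟩ | ⟨i, hi, k, -, rfl⟩
  · exact Or.inl ⟨k, h (0, k) (by simp [mem_vert]), rfl⟩
  · exact Or.inr ⟨i, hi, k, h (i, k + 1) (by simp [mem_horiz]), rfl⟩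

/-- `B` is a domino tiling of the columns `m, …, n - 1` of the board. -/
structure IsBlock (m n : ℕ) (B : Finset (Finset (ℕ × ℕ))) : Prop where
  isDomino : ∀ d ∈ B, IsDomino n d
  covers_iff : ∀ c : ℕ × ℕ, (c.1 < 2 ∧ m ≤ c.2 ∧ c.2 < n) ↔ ∃ d ∈ B, c ∈ d
  disjoint : ∀ d ∈ B, ∀ e ∈ B, d ≠ e → Disjoint d e

lemma isBlock_vert (m : ℕ) : IsBlock m (m + 1) {Vert m} where
  isDomino d hd := Or.inl ⟨m, m.lt_succ_self, Finset.mem_singleton.1 hd⟩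
  covers_iff c := by
    simp only [Finset.mem_singleton, exists_eq_left, mem_vert]
    omega
  disjoint d hd e he hde := by simp_all

lemma isBlock_horiz (m : ℕ) : IsBlock m (m + 2) {Horiz 0 m, Horiz 1 m} where
  isDomino d hd := by
    rw [Finset.mem_insert, Finset.mem_singleton] at hd
    rcases hd with rfl | rfl
    · exact Or.inr ⟨0, by simp, m, by omega, rfl⟩
    · exact Or.inr ⟨1, by simp, m, by omega, rfl⟩
  covers_iff c := by
    simp only [Finset.mem_insert, Finset.mem_singleton, exists_eq_or_imp, exists_eq_left,
      mem_horiz]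
    omega
  disjoint := by
    have h : Disjoint (Horiz 0 m) (Horiz 1 m) := Finset.disjoint_left.2 fun c h₁ h₂ ↦ by
      rw [mem_horiz] at h₁ h₂
      omega
    intro d hd e he hde
    rw [Finset.mem_insert, Finset.mem_singleton] at hd he
    rcases hd with rfl | rfl <;> rcases he with rfl | rfl
    · exact absurd rfl hde
    · exact h
    · exact h.symm
    · exact absurd rfl hde

section Block

variable {m n : ℕ} {B T : Finset (Finset (ℕ × ℕ))}

lemma IsBlock.disjoint_of_isTiling (hB : IsBlock m n B) (hT : IsTiling m T) {d e : Finset (ℕ × ℕ)}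
    (hd : d ∈ B) (he : e ∈ T) : Disjoint d e :=
  Finset.disjoint_left.2 fun c hcd hce ↦ by
    have h₁ := (hB.covers_iff c).2 ⟨d, hd, hcd⟩
    have h₂ := (hT.2.1 c).2 ⟨e, he, hce⟩
    omega

lemma IsBlock.disjoint_isTiling (hB : IsBlock m n B) (hT : IsTiling m T) : Disjoint B T :=
  Finset.disjoint_left.2 fun d hdB hdT ↦ by
    obtain ⟨c, hc⟩ := (hT.1 d hdT).nonempty
    exact Finset.disjoint_left.1 (hB.disjoint_of_isTiling hT hdB hdT) hc hc

lemma IsBlock.isTiling_union (hB : IsBlock m n B) (hmn : m ≤ n) (hT : IsTiling m T) :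
    IsTiling n (B ∪ T) := by
  refine ⟨fun d hd ↦ ?_, fun c ↦ ?_, fun d hd e he hde ↦ ?_⟩
  · rcases Finset.mem_union.1 hd with hd | hd
    · exact hB.isDomino d hd
    · exact (hT.1 d hd).mono hmn
  · have h₁ := hB.covers_iff c
    have h₂ := hT.2.1 c
    simp only [Finset.mem_union, or_and_right, exists_or, ← h₁, ← h₂]
    omega
  · rcases Finset.mem_union.1 hd with hd | hd <;> rcases Finset.mem_union.1 he with he | he
    · exact hB.disjoint d hd e he hde
    · exact hB.disjoint_of_isTiling hT hd he
    · exact (hB.disjoint_of_isTiling hT he hd).symm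
    · exact hT.2.2 d hd e he hde

lemma IsBlock.isTiling_sdiff (hB : IsBlock m n B) (hmn : m ≤ n) (hT : IsTiling n T)
    (hBT : B ⊆ T) : IsTiling m (T \ B) := by
  have hlt : ∀ d ∈ T \ B, ∀ c ∈ d, c.1 < 2 ∧ c.2 < m := by
    intro d hd c hc
    rw [Finset.mem_sdiff] at hd
    have hcn := (hT.2.1 c).2 ⟨d, hd.1, hc⟩
    refine ⟨hcn.1, ?_⟩
    by_contra! hmc
    obtain ⟨e, he, hce⟩ := (hB.covers_iff c).1 ⟨hcn.1, hmc, hcn.2⟩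
    have hde : d ≠ e := fun h ↦ hd.2 (h ▸ he)
    exact Finset.disjoint_left.1 (hT.2.2 d hd.1 e (hBT he) hde) hc hce
  refine ⟨fun d hd ↦ ?_, fun c ↦ ⟨fun hc ↦ ?_, ?_⟩, fun d hd e he hde ↦ ?_⟩
  · exact (hT.1 d (Finset.mem_sdiff.1 hd).1).restrict fun c hc ↦ (hlt d hd c hc).2
  · obtain ⟨d, hd, hcd⟩ := (hT.2.1 c).1 ⟨hc.1, hc.2.trans_le hmn⟩
    refine ⟨d, Finset.mem_sdiff.2 ⟨hd, fun hdB ↦ ?_⟩, hcd⟩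
    have := (hB.covers_iff c).2 ⟨d, hdB, hcd⟩
    omega
  · rintro ⟨d, hd, hcd⟩
    exact hlt d hd c hcd
  · exact hT.2.2 d (Finset.mem_sdiff.1 hd).1 e (Finset.mem_sdiff.1 he).1 hde

end Block

lemma isTiling_zero_iff {T : Finset (Finset (ℕ × ℕ))} : IsTiling 0 T ↔ T = ∅ := by
  constructor
  · intro hT
    refine Finset.eq_empty_of_forall_notMem fun d hd ↦ ?_
    obtain ⟨c, hc⟩ := (hT.1 d hd).nonempty
    simpa using (hT.2.1 c).2 ⟨d, hd, hc⟩
  · rintro rfl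
    simp [IsTiling]

lemma IsTiling.vert_or_horiz {m i : ℕ} (hi : i < 2) {T : Finset (Finset (ℕ × ℕ))}
    (hT : IsTiling (m + 2) T) : Vert (m + 1) ∈ T ∨ Horiz i m ∈ T := by
  obtain ⟨d, hd, hcd⟩ := (hT.2.1 (i, m + 1)).1 ⟨hi, by simp⟩
  rcases hT.1 d hd with ⟨k, -, rfl⟩ | ⟨j, -, k, hk, rfl⟩
  · rw [mem_vert] at hcd
    obtain rfl : m + 1 = k := hcd.2
    exact Or.inl hd
  · rw [mem_horiz] at hcd
    simp only at hcd
    obtain ⟨rfl, rfl⟩ : i = j ∧ m = k := by omega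
    exact Or.inr hd

lemma isTiling_one_iff {T : Finset (Finset (ℕ × ℕ))} : IsTiling 1 T ↔ T = {Vert 0} := by
  constructor
  · intro hT
    obtain ⟨d, hd, hcd⟩ := (hT.2.1 (0, 0)).1 (by simp)
    have hvert : {Vert 0} ⊆ T := by
      rcases hT.1 d hd with ⟨k, hk, rfl⟩ | ⟨j, -, k, hk, rfl⟩
      · obtain rfl : k = 0 := by omega
        simpa using hd
      · omega
    have := isTiling_zero_iff.1 ((isBlock_vert 0).isTiling_sdiff (by simp) hT hvert)
    exact (Finset.sdiff_eq_empty_iff_subset.1 this).antisymm hvert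
  · rintro rfl
    simpa using (isBlock_vert 0).isTiling_union (by simp) (isTiling_zero_iff.2 rfl)

lemma isTiling_add_two_iff {m : ℕ} {T : Finset (Finset (ℕ × ℕ))} :
    IsTiling (m + 2) T ↔ (∃ T', IsTiling (m + 1) T' ∧ T = {Vert (m + 1)} ∪ T') ∨
      ∃ T', IsTiling m T' ∧ T = {Horiz 0 m, Horiz 1 m} ∪ T' := by
  constructor
  · intro hT
    by_cases hv : Vert (m + 1) ∈ T
    · have hsub : {Vert (m + 1)} ⊆ T := by simpa using hv
      exact Or.inl ⟨_, (isBlock_vert (m + 1)).isTiling_sdiff (by omega) hT hsub,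
        (Finset.union_sdiff_of_subset hsub).symm⟩
    · have hsub : {Horiz 0 m, Horiz 1 m} ⊆ T := by
        rw [Finset.insert_subset_iff, Finset.singleton_subset_iff]
        exact ⟨(hT.vert_or_horiz (by simp)).resolve_left hv,
          (hT.vert_or_horiz (by simp)).resolve_left hv⟩
      exact Or.inr ⟨_, (isBlock_horiz m).isTiling_sdiff (by omega) hT hsub,
        (Finset.union_sdiff_of_subset hsub).symm⟩
  · rintro (⟨T', hT', rfl⟩ | ⟨T', hT', rfl⟩)
    · exact (isBlock_vert (m + 1)).isTiling_union (by omega) hT'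
    · exact (isBlock_horiz m).isTiling_union (by omega) hT'

end Tilings

section DominoIdeal

open MvPolynomial

variable (K : Type*) [Field K]

lemma dominoIdealIn_zero (n : ℕ) : dominoIdealIn K n 0 = ⊤ := by
  rw [Ideal.eq_top_iff_one]
  exact Ideal.subset_span ⟨∅, isTiling_zero_iff.2 rfl, by simp [dominoMonomial]⟩

lemma dominoMonomial_vert (n k : ℕ) : dominoMonomial K n {Vert k} = X (Sum.inr (k + 1)) := by
  rw [dominoMonomial, Finset.prod_singleton, dominoVar_vert]

lemma dominoMonomial_horiz (n k : ℕ) : dominoMonomial K n {Horiz 0 k, Horiz 1 k} =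
    X (Sum.inl (k + 1)) * X (Sum.inl (n + k)) := by
  rw [dominoMonomial, Finset.prod_pair fun h ↦ zero_ne_one (horiz_eq_iff.1 h).1,
    dominoVar_horiz_zero, dominoVar_horiz_one]

lemma dominoMonomial_union (n : ℕ) {B T : Finset (Finset (ℕ × ℕ))} (h : Disjoint B T) :
    dominoMonomial K n (B ∪ T) = dominoMonomial K n B * dominoMonomial K n T :=
  Finset.prod_union h

lemma dominoIdealIn_one (n : ℕ) : dominoIdealIn K n 1 = Ideal.span {X (Sum.inr 1)} := by
  simp_rw [dominoIdealIn, isTiling_one_iff, exists_eq_left, dominoMonomial_vert]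
  rfl

lemma dominoIdealIn_add_two (n m : ℕ) : dominoIdealIn K n (m + 2) =
    Ideal.span {X (Sum.inr (m + 2))} * dominoIdealIn K n (m + 1) ⊔
      Ideal.span {X (Sum.inl (m + 1)) * X (Sum.inl (n + m))} * dominoIdealIn K n m := by
  simp only [dominoIdealIn, Ideal.span_mul_span', ← Ideal.span_union, Set.singleton_mul]
  congr 1
  ext f
  simp only [Set.mem_ofPred_eq, isTiling_add_two_iff, Set.mem_union, Set.mem_image]
  constructor
  · rintro ⟨T, ⟨T', hT', rfl⟩ | ⟨T', hT', rfl⟩, rfl⟩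
    · refine Or.inl ⟨_, ⟨T', hT', rfl⟩, ?_⟩
      rw [dominoMonomial_union K n ((isBlock_vert (m + 1)).disjoint_isTiling hT'),
        dominoMonomial_vert]
    · refine Or.inr ⟨_, ⟨T', hT', rfl⟩, ?_⟩
      rw [dominoMonomial_union K n ((isBlock_horiz m).disjoint_isTiling hT'),
        dominoMonomial_horiz]
  · rintro (⟨_, ⟨T', hT', rfl⟩, rfl⟩ | ⟨_, ⟨T', hT', rfl⟩, rfl⟩)
    · refine ⟨_, Or.inl ⟨T', hT', rfl⟩, ?_⟩
      rw [dominoMonomial_union K n ((isBlock_vert (m + 1)).disjoint_isTiling hT'),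
        dominoMonomial_vert]
    · refine ⟨_, Or.inr ⟨T', hT', rfl⟩, ?_⟩
      rw [dominoMonomial_union K n ((isBlock_horiz m).disjoint_isTiling hT'),
        dominoMonomial_horiz]

/-- A variable is a nonzerodivisor modulo an ideal generated by monomials not involving it. -/
lemma mem_span_monomial_of_X_mul_mem {σ R : Type*} [CommRing R] {s : Set (σ →₀ ℕ)} {i : σ}
    (hs : ∀ a ∈ s, a i = 0) {c : MvPolynomial σ R}
    (hc : X i * c ∈ Ideal.span ((fun a ↦ monomial a (1 : R)) '' s)) :
    c ∈ Ideal.span ((fun a ↦ monomial a (1 : R)) '' s) := by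
  rw [mem_ideal_span_monomial_image] at hc ⊢
  intro a ha
  obtain ⟨b, hb, hle⟩ := hc (Finsupp.single i 1 + a)
    (by rwa [mem_support_iff, coeff_X_mul, ← mem_support_iff])
  refine ⟨b, hb, fun j ↦ ?_⟩
  by_cases hj : i = j
  · subst hj
    simp [hs b hb]
  · simpa [Finsupp.single_apply, hj] using hle j

lemma dominoIdealIn_eq_span_monomial (n m : ℕ) : dominoIdealIn K n m =
    Ideal.span ((fun a ↦ monomial a (1 : K)) ''
      ((fun T ↦ ∑ d ∈ T, Finsupp.single (dominoVar n d) 1) '' {T | IsTiling m T})) := by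
  rw [dominoIdealIn, Set.image_image]
  congr 1
  ext f
  simp only [Set.mem_ofPred_eq, Set.mem_image, monomial_sum_one, eq_comm (a := f)]
  rfl

variable {K}

lemma mem_dominoIdealIn_of_X_mul_mem {n m : ℕ} {i : ℕ ⊕ ℕ}
    (hi : ∀ d, IsDomino m d → dominoVar n d ≠ i) {c : MvPolynomial (ℕ ⊕ ℕ) K}
    (hc : X i * c ∈ dominoIdealIn K n m) : c ∈ dominoIdealIn K n m := by
  rw [dominoIdealIn_eq_span_monomial] at hc ⊢
  refine mem_span_monomial_of_X_mul_mem ?_ hc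
  rintro _ ⟨T, hT, rfl⟩
  rw [Finsupp.finsetSum_apply]
  exact Finset.sum_eq_zero fun d hd ↦ Finsupp.single_eq_of_ne (hi d (hT.1 d hd)).symm

lemma dominoVar_mem {n m : ℕ} {d : Finset (ℕ × ℕ)} (hd : IsDomino m d) :
    (∃ k < m, dominoVar n d = Sum.inr (k + 1)) ∨
      ∃ k, k + 1 < m ∧ (dominoVar n d = Sum.inl (k + 1) ∨ dominoVar n d = Sum.inl (n + k)) := by
  rcases hd with ⟨k, hk, rfl⟩ | ⟨i, hi, k, hk, rfl⟩
  · exact Or.inl ⟨k, hk, dominoVar_vert n k⟩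
  · refine Or.inr ⟨k, hk, ?_⟩
    interval_cases i
    · exact Or.inl (dominoVar_horiz_zero n k)
    · exact Or.inr (dominoVar_horiz_one n k)

variable (K)

lemma isCoprimeRecursion_dominoIdealIn (n : ℕ) :
    IsCoprimeRecursion n (fun m ↦ (X (Sum.inr (m + 1)) : MvPolynomial (ℕ ⊕ ℕ) K))
      (fun m ↦ X (Sum.inl (m + 1)) * X (Sum.inl (n + m))) (dominoIdealIn K n) where
  zero := dominoIdealIn_zero K n
  one := dominoIdealIn_one K n
  mem_iff m f := by
    simp only [dominoIdealIn_add_two, Submodule.mem_sup, Ideal.mem_span_singleton_mul]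
    constructor
    · rintro ⟨_, ⟨p, hp, rfl⟩, _, ⟨q, hq, rfl⟩, rfl⟩
      exact ⟨p, hp, q, hq, rfl⟩
    · rintro ⟨p, hp, q, hq, rfl⟩
      exact ⟨_, ⟨p, hp, rfl⟩, _, ⟨q, hq, rfl⟩, rfl⟩
  y_ne_zero m := X_ne_zero _
  z_ne_zero m := mul_ne_zero (X_ne_zero _) (X_ne_zero _)
  dvd_of_mul_eq m a b hab := by
    have hp : Prime (X (Sum.inr (m + 1 + 1)) : MvPolynomial (ℕ ⊕ ℕ) K) :=
      X_prime
    rcases hp.dvd_or_dvd (Dvd.intro a hab) with h | h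
    · rcases hp.dvd_or_dvd h with h | h <;> simp [X_dvd_X] at h
    · exact h
  mem_of_y_mul_mem k m c hkm hc := by
    refine mem_dominoIdealIn_of_X_mul_mem (fun d hd h ↦ ?_) hc
    rcases dominoVar_mem (n := n) hd with ⟨l, hl, h'⟩ | ⟨l, hl, h' | h'⟩ <;> rw [h] at h'
    · have := Sum.inr.inj h'
      omega
    · cases h'
    · cases h'
  mem_of_z_mul_mem m c hm hc := by
    have hvar : ∀ j, j = m + 1 ∨ j = n + m → ∀ d, IsDomino (m + 1) d →
        dominoVar n d ≠ Sum.inl j := by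
      intro j hj d hd h
      rcases dominoVar_mem (n := n) hd with ⟨l, hl, h'⟩ | ⟨l, hl, h' | h'⟩ <;> rw [h] at h'
      · cases h'
      · have := Sum.inl.inj h'
        omega
      · have := Sum.inl.inj h'
        omega
    rw [mul_assoc] at hc
    exact mem_dominoIdealIn_of_X_mul_mem (hvar _ (Or.inr rfl))
      (mem_dominoIdealIn_of_X_mul_mem (hvar _ (Or.inl rfl)) hc)

end DominoIdeal

/-- pd(I_n) = n - 1 for all n ≥ 1, i.e. every minimal graded free
resolution of the domino ideal has length n - 1. -/
theorem pd_domino_ideal (K : Type*) [Field K] :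
    ∀ n : ℕ, 1 ≤ n →
      ∀ F : MinimalFreeResolution (dominoIdeal K n), F.len = n - 1 := by
  intro n hn F
  obtain ⟨m, rfl⟩ : ∃ m, n = m + 1 := ⟨n - 1, by omega⟩
  have h := isCoprimeRecursion_dominoIdealIn K (m + 1)
  have hX (i : ℕ ⊕ ℕ) : (MvPolynomial.X i : MvPolynomial (ℕ ⊕ ℕ) K) ∈
      MvPolynomial.idealOfVars (ℕ ⊕ ℕ) K := Ideal.subset_span ⟨i, rfl⟩
  have hpd := h.not_pdLT ((Ideal.ne_top_iff_one _).2 (one_notMem_idealOfVars (ℕ ⊕ ℕ) K))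
    (fun _ ↦ hX _) (fun _ ↦ Ideal.mul_mem_right _ _ (hX _)) m le_rfl
  refine le_antisymm (F.len_le_of_pdLT (h.pdLT m le_rfl)) ?_
  by_contra! hlt
  exact hpd (F.pdLT_len.mono (by omega))
end

section
/- Let I_n be the domino ideal of the 2×n rectangle. Then the Castelnuovo–Mumford regularity of I_n equals 2n − 1. -/
open scoped Classical

namespace GradedFree

open MvPolynomial Finsupp

variable {K : Type*} [Field K] {σ : Type*} {ι κ μ : Type}

/-- The elements of a graded free module all of whose monomial terms have total degree in `S`,
where the basis element `g` sits in degree `deg g`. -/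
def degreeSupported (deg : ι → ℕ) (S : Set ℕ) : AddSubgroup (ι →₀ MvPolynomial σ K) where
  carrier := {v | ∀ g m, coeff m (v g) ≠ 0 → m.degree + deg g ∈ S}
  zero_mem' := by simp
  add_mem' := by
    intro a b ha hb g m h
    by_cases h1 : coeff m (a g) = 0
    · by_cases h2 : coeff m (b g) = 0
      · simp [h1, h2] at h
      · exact hb g m h2
    · exact ha g m h1
  neg_mem' := by
    intro a ha g m h
    exact ha g m (by simpa using h)

/-- A linear map of graded free modules is graded when it preserves the degrees of the basis. -/
def IsGraded (degι : ι → ℕ) (degκ : κ → ℕ)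
    (φ : (ι →₀ MvPolynomial σ K) →ₗ[MvPolynomial σ K] (κ →₀ MvPolynomial σ K)) : Prop :=
  ∀ g, φ (single g 1) ∈ degreeSupported degκ {degι g}

theorem monomial_smul_mem {deg : ι → ℕ} {k : ℕ} {v : ι →₀ MvPolynomial σ K}
    (hv : v ∈ degreeSupported deg {k}) (s : σ →₀ ℕ) (c : K) :
    (monomial s c : MvPolynomial σ K) • v ∈ degreeSupported deg {k + s.degree} := by
  intro g m h
  rw [Finsupp.smul_apply, smul_eq_mul, coeff_monomial_mul'] at h
  split_ifs at h with hs
  · have h1 := hv g (m - s) (right_ne_zero_of_mul h)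
    obtain ⟨t, rfl⟩ := exists_add_of_le hs
    simp only [add_tsub_cancel_left, Set.mem_singleton_iff, map_add] at h1 ⊢
    omega
  · exact absurd rfl h

theorem degreeSupported_mono {deg : ι → ℕ} {S T : Set ℕ} (h : S ⊆ T) :
    (degreeSupported deg S : AddSubgroup (ι →₀ MvPolynomial σ K)) ≤ degreeSupported deg T :=
  fun _ hv g m hm => h (hv g m hm)

theorem IsGraded.map_mem {degι : ι → ℕ} {degκ : κ → ℕ}
    {φ : (ι →₀ MvPolynomial σ K) →ₗ[MvPolynomial σ K] (κ →₀ MvPolynomial σ K)}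
    (hφ : IsGraded degι degκ φ) {S : Set ℕ} {v : ι →₀ MvPolynomial σ K}
    (hv : v ∈ degreeSupported degι S) : φ v ∈ degreeSupported degκ S := by
  rw [← Finsupp.sum_single v, Finsupp.sum, map_sum]
  refine sum_mem fun g _ => ?_
  have e : single g (v g) = ∑ m ∈ (v g).support, monomial m (coeff m (v g)) •
      (single g 1 : ι →₀ MvPolynomial σ K) := by
    rw [← Finset.sum_smul, support_sum_monomial_coeff, smul_single_one]
  rw [e, map_sum]
  refine sum_mem fun m hm => ?_
  rw [map_smul]
  refine degreeSupported_mono ?_ (monomial_smul_mem (hφ g) m _)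
  rw [Set.singleton_subset_iff, add_comm]
  exact hv g m (MvPolynomial.mem_support_iff.1 hm)

theorem IsGraded.comp {degι : ι → ℕ} {degκ : κ → ℕ} {degμ : μ → ℕ}
    {ψ : (κ →₀ MvPolynomial σ K) →ₗ[MvPolynomial σ K] (μ →₀ MvPolynomial σ K)}
    {φ : (ι →₀ MvPolynomial σ K) →ₗ[MvPolynomial σ K] (κ →₀ MvPolynomial σ K)}
    (hψ : IsGraded degκ degμ ψ) (hφ : IsGraded degι degκ φ) :
    IsGraded degι degμ (ψ ∘ₗ φ) := fun g => hψ.map_mem (hφ g)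

theorem exists_degreeSupported_add (deg : ι → ℕ) (S : Set ℕ) (u : ι →₀ MvPolynomial σ K) :
    ∃ v ∈ degreeSupported deg S, ∃ r ∈ degreeSupported deg Sᶜ, u = v + r := by
  induction u using Finsupp.induction_linear with
  | zero => exact ⟨0, zero_mem _, 0, zero_mem _, by simp⟩
  | add a b ha hb =>
    obtain ⟨v, hv, r, hr, rfl⟩ := ha
    obtain ⟨v', hv', r', hr', rfl⟩ := hb
    exact ⟨v + v', add_mem hv hv', r + r', add_mem hr hr', by abel⟩
  | single g p =>
    induction p using MvPolynomial.induction_on' with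
    | add p q hp hq =>
      obtain ⟨v, hv, r, hr, h⟩ := hp
      obtain ⟨v', hv', r', hr', h'⟩ := hq
      exact ⟨v + v', add_mem hv hv', r + r', add_mem hr hr', by rw [single_add, h, h']; abel⟩
    | monomial m c =>
      have key : ∀ T : Set ℕ, m.degree + deg g ∈ T →
          (single g (monomial m c) : ι →₀ MvPolynomial σ K) ∈ degreeSupported deg T := by
        intro T hT g' m' h
        by_cases hg : g = g'
        · subst hg
          rw [single_eq_same, coeff_monomial] at h
          split_ifs at h with hm
          · exact hm ▸ hT
          · exact absurd rfl h
        · rw [single_eq_of_ne (Ne.symm hg)] at h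
          simp at h
      by_cases h : m.degree + deg g ∈ S
      · exact ⟨_, key S h, 0, zero_mem _, by simp⟩
      · exact ⟨0, zero_mem _, _, key Sᶜ h, by simp⟩

theorem eq_zero_of_mem_degreeSupported {deg : ι → ℕ} {S : Set ℕ} {v : ι →₀ MvPolynomial σ K}
    (h : v ∈ degreeSupported deg S) (h' : v ∈ degreeSupported deg Sᶜ) : v = 0 := by
  ext g m
  by_contra hm
  exact h' g m hm (h g m hm)

/-- Graded maps out of graded free modules lift along graded maps. -/
theorem exists_graded_lift {degι : ι → ℕ} {degκ : κ → ℕ} {degμ : μ → ℕ}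
    {φ : (ι →₀ MvPolynomial σ K) →ₗ[MvPolynomial σ K] (μ →₀ MvPolynomial σ K)}
    {ψ : (κ →₀ MvPolynomial σ K) →ₗ[MvPolynomial σ K] (μ →₀ MvPolynomial σ K)}
    (hφ : IsGraded degι degμ φ) (hψ : IsGraded degκ degμ ψ)
    (h : LinearMap.range φ ≤ LinearMap.range ψ) :
    ∃ f : (ι →₀ MvPolynomial σ K) →ₗ[MvPolynomial σ K] (κ →₀ MvPolynomial σ K),
      IsGraded degι degκ f ∧ ∀ x, ψ (f x) = φ x := by
  have key : ∀ g, ∃ v ∈ degreeSupported degκ {degι g}, ψ v = φ (single g 1) := by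
    intro g
    obtain ⟨u, hu⟩ := h (LinearMap.mem_range_self φ (single g 1))
    obtain ⟨v, hv, r, hr, rfl⟩ := exists_degreeSupported_add degκ {degι g} u
    refine ⟨v, hv, ?_⟩
    rw [map_add] at hu
    have e : ψ r = φ (single g 1) - ψ v := eq_sub_of_add_eq' hu
    have h0 : ψ r = 0 := eq_zero_of_mem_degreeSupported
      (e ▸ sub_mem (hφ g) (hψ.map_mem hv)) (hψ.map_mem hr)
    rw [← hu, h0, add_zero]
  choose v hv hv' using key
  refine ⟨Finsupp.linearCombination _ v, fun g => by simpa using hv g, fun x => ?_⟩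
  induction x using Finsupp.induction_linear with
  | zero => simp
  | add a b ha hb => simp only [map_add, ha, hb]
  | single g p =>
    rw [linearCombination_single, map_smul, hv', ← map_smul, smul_single_one]

/-- The elements of a free module all of whose coordinates have no constant term. -/
def irrelevant (K σ : Type*) [Field K] (ι : Type) :
    Submodule (MvPolynomial σ K) (ι →₀ MvPolynomial σ K) where
  carrier := {v | ∀ g, constantCoeff (v g) = 0}
  zero_mem' := by simp
  add_mem' := by
    intro a b ha hb g
    simp [ha g, hb g]
  smul_mem' := by
    intro c a ha g
    simp [ha g]

theorem map_mem_irrelevant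
    (φ : (ι →₀ MvPolynomial σ K) →ₗ[MvPolynomial σ K] (κ →₀ MvPolynomial σ K))
    {v : ι →₀ MvPolynomial σ K} (hv : v ∈ irrelevant K σ ι) : φ v ∈ irrelevant K σ κ := by
  rw [← Finsupp.sum_single v, Finsupp.sum, map_sum]
  refine sum_mem fun g _ => ?_
  rw [← smul_single_one, map_smul]
  intro g'
  simp [hv g]

theorem map_mem_irrelevant_of_single
    {φ : (ι →₀ MvPolynomial σ K) →ₗ[MvPolynomial σ K] (κ →₀ MvPolynomial σ K)}
    (hφ : ∀ g, φ (single g 1) ∈ irrelevant K σ κ) (v : ι →₀ MvPolynomial σ K) :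
    φ v ∈ irrelevant K σ κ := by
  rw [← Finsupp.sum_single v, Finsupp.sum, map_sum]
  refine sum_mem fun g _ => ?_
  rw [← smul_single_one, map_smul]
  exact Submodule.smul_mem _ _ (hφ g)

/-- A graded free resolution, with minimal differentials, of an ideal of a polynomial ring;
the ambient ring is realized as the free module on one generator of degree `0`. -/
structure Resolution (I : Ideal (MvPolynomial σ K)) where
  ι : ℕ → Type
  deg : ∀ i, ι i → ℕ
  ε : (ι 0 →₀ MvPolynomial σ K) →ₗ[MvPolynomial σ K] (Unit →₀ MvPolynomial σ K)
  d : ∀ i, (ι (i + 1) →₀ MvPolynomial σ K) →ₗ[MvPolynomial σ K] (ι i →₀ MvPolynomial σ K)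
  ε_graded : IsGraded (deg 0) (fun _ => 0) ε
  ε_range : ∀ x, x ∈ LinearMap.range ε ↔ x () ∈ I
  d_graded : ∀ i, IsGraded (deg (i + 1)) (deg i) (d i)
  d_minimal : ∀ i g, d i (single g 1) ∈ irrelevant K σ (ι i)
  exact_zero : LinearMap.ker ε = LinearMap.range (d 0)
  exact : ∀ i, LinearMap.ker (d i) = LinearMap.range (d (i + 1))

namespace Resolution

variable {I J : Ideal (MvPolynomial σ K)}

theorem ε_d (A : Resolution I) (x) : A.ε (A.d 0 x) = 0 := by
  have : A.d 0 x ∈ LinearMap.ker A.ε := A.exact_zero ▸ LinearMap.mem_range_self _ x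
  exact this

theorem d_d (A : Resolution I) (i : ℕ) (x) : A.d i (A.d (i + 1) x) = 0 := by
  have : A.d (i + 1) x ∈ LinearMap.ker (A.d i) := A.exact i ▸ LinearMap.mem_range_self _ x
  exact this

theorem exists_of_ε_eq_zero (A : Resolution I) {x} (h : A.ε x = 0) : ∃ z, A.d 0 z = x := by
  have : x ∈ LinearMap.ker A.ε := h
  rwa [A.exact_zero] at this

theorem exists_of_d_eq_zero (A : Resolution I) {i : ℕ} {x} (h : A.d i x = 0) :
    ∃ z, A.d (i + 1) z = x := by
  have : x ∈ LinearMap.ker (A.d i) := h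
  rwa [A.exact i] at this

/-- `A` has a generator in homological degree `i` and internal degree `j`. -/
def HasGen (A : Resolution I) (i j : ℕ) : Prop := ∃ g, A.deg i g = j

/-- An inclusion of ideals lifts to a graded map of resolutions. -/
theorem exists_lift (A : Resolution I) (B : Resolution J) (h : I ≤ J) :
    ∃ f : ∀ i, (A.ι i →₀ MvPolynomial σ K) →ₗ[MvPolynomial σ K] (B.ι i →₀ MvPolynomial σ K),
      (∀ i, IsGraded (A.deg i) (B.deg i) (f i)) ∧ (∀ x, B.ε (f 0 x) = A.ε x) ∧
      ∀ i x, B.d i (f (i + 1) x) = f i (A.d i x) := by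
  let S : ℕ → Type _ := fun i =>
    {f : (A.ι i →₀ MvPolynomial σ K) →ₗ[MvPolynomial σ K] (B.ι i →₀ MvPolynomial σ K) //
      IsGraded (A.deg i) (B.deg i) f ∧ ∀ x, f (A.d i x) ∈ LinearMap.range (B.d i)}
  have step : ∀ i (s : S i), ∃ t : S (i + 1), ∀ x, B.d i (t.1 x) = s.1 (A.d i x) := by
    rintro i ⟨f, hf, hf'⟩
    obtain ⟨t, ht, ht'⟩ := exists_graded_lift (hf.comp (A.d_graded i)) (B.d_graded i)
      (by rintro _ ⟨x, rfl⟩; exact hf' x)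
    refine ⟨⟨t, ht, fun x => ?_⟩, ht'⟩
    rw [← B.exact i, LinearMap.mem_ker, ht', LinearMap.comp_apply, A.d_d, map_zero]
  choose next hnext using step
  obtain ⟨f, hf, hf'⟩ := exists_graded_lift A.ε_graded B.ε_graded
    (fun x hx => (B.ε_range x).2 (h ((A.ε_range x).1 hx)))
  have s0 : ∀ x, f (A.d 0 x) ∈ LinearMap.range (B.d 0) := fun x => by
    rw [← B.exact_zero, LinearMap.mem_ker, hf', A.ε_d]
  let s : ∀ i, S i := fun i => Nat.rec ⟨f, hf, s0⟩ next i
  exact ⟨fun i => (s i).1, fun i => (s i).2.1, hf', fun i x => hnext i (s i) x⟩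

/-- An endomorphism of a minimal resolution lifting zero is zero modulo the irrelevant ideal. -/
theorem mem_irrelevant_of_lift_zero (A : Resolution I)
    (h : ∀ i, (A.ι i →₀ MvPolynomial σ K) →ₗ[MvPolynomial σ K] (A.ι i →₀ MvPolynomial σ K))
    (h0 : ∀ x, A.ε (h 0 x) = 0) (hd : ∀ i x, A.d i (h (i + 1) x) = h i (A.d i x)) (i : ℕ) (x) :
    h i x ∈ irrelevant K σ (A.ι i) := by
  have lift : ∀ (i j : ℕ)
      (u : (A.ι j →₀ MvPolynomial σ K) →ₗ[MvPolynomial σ K] (A.ι i →₀ MvPolynomial σ K)),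
      (∀ x, u x ∈ LinearMap.range (A.d i)) → ∃ s : (A.ι j →₀ MvPolynomial σ K)
        →ₗ[MvPolynomial σ K] (A.ι (i + 1) →₀ MvPolynomial σ K), ∀ x, A.d i (s x) = u x := by
    intro i j u hu
    choose v hv using fun g => hu (single g 1)
    refine ⟨Finsupp.linearCombination _ v, fun x => ?_⟩
    induction x using Finsupp.induction_linear with
    | zero => simp
    | add a b ha hb => simp only [map_add, ha, hb]
    | single g p => rw [linearCombination_single, map_smul, hv, ← map_smul, smul_single_one]
  have key : ∀ i, ∃ s : (A.ι i →₀ MvPolynomial σ K) →ₗ[MvPolynomial σ K]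
      (A.ι (i + 1) →₀ MvPolynomial σ K), (∀ x, h i (A.d i x) = A.d i (s (A.d i x))) ∧
        ∀ x, h i x - A.d i (s x) ∈ irrelevant K σ (A.ι i) := by
    intro i
    induction i with
    | zero =>
      obtain ⟨s, hs⟩ := lift 0 0 (h 0) (fun x => by
        rw [← A.exact_zero]; exact h0 x)
      exact ⟨s, fun x => (hs _).symm, fun x => by rw [hs, sub_self]; exact zero_mem _⟩
    | succ i ih =>
      obtain ⟨s, hs, -⟩ := ih
      obtain ⟨t, ht⟩ := lift (i + 1) (i + 1) (h (i + 1) - s ∘ₗ A.d i) (fun x => by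
        rw [← A.exact i, LinearMap.mem_ker, LinearMap.sub_apply, map_sub, hd, hs,
          LinearMap.comp_apply, sub_self])
      refine ⟨t, fun x => ?_, fun x => ?_⟩
      · rw [ht, LinearMap.sub_apply, LinearMap.comp_apply, A.d_d, map_zero, sub_zero]
      · rw [ht, LinearMap.sub_apply, sub_sub_cancel, LinearMap.comp_apply]
        exact map_mem_irrelevant _ (map_mem_irrelevant_of_single (A.d_minimal i) x)
  obtain ⟨s, -, hs⟩ := key i
  have := add_mem (hs x) (map_mem_irrelevant_of_single (A.d_minimal i) (s x))
  rwa [sub_add_cancel] at this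

/-- The degrees of the generators of a minimal resolution do not depend on the resolution. -/
theorem HasGen.of_hasGen {A : Resolution I} {i j : ℕ} (hA : A.HasGen i j) (B : Resolution I) :
    B.HasGen i j := by
  obtain ⟨g, rfl⟩ := hA
  by_contra hB
  obtain ⟨f, hf, hf0, hfd⟩ := A.exists_lift B le_rfl
  obtain ⟨f', -, hf0', hfd'⟩ := B.exists_lift A le_rfl
  have h1 := A.mem_irrelevant_of_lift_zero (fun i => f' i ∘ₗ f i - LinearMap.id)
    (fun x => by simp [hf0', hf0]) (fun i x => by simp [hfd', hfd]) i (single g 1)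
  have h2 : f i (single g 1) ∈ irrelevant K σ (B.ι i) := by
    intro g'
    by_contra hne
    refine hB ⟨g', ?_⟩
    simpa using hf i g g' 0 (by simpa [constantCoeff_eq] using hne)
  have h3 := sub_mem (map_mem_irrelevant (f' i) h2) h1
  have h4 := h3 g
  simp at h4

/-- The generators of a resolution of a principal ideal. -/
def PrincipalGen : ℕ → Type
  | 0 => Unit
  | _ + 1 => Empty

instance : Unique (PrincipalGen 0) := inferInstanceAs (Unique Unit)

instance (i : ℕ) : IsEmpty (PrincipalGen (i + 1)) := inferInstanceAs (IsEmpty Empty)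

/-- The resolution of the principal ideal generated by a monomial. -/
noncomputable def principal {I : Ideal (MvPolynomial σ K)} (s : σ →₀ ℕ)
    (hI : I = Ideal.span {monomial s 1}) : Resolution I where
  ι := PrincipalGen
  deg := fun _ _ => s.degree
  ε := Finsupp.linearCombination _ fun _ => single () (monomial s 1)
  d := fun _ => 0
  ε_graded := by
    intro g g' m hm
    rw [linearCombination_single, one_smul, single_eq_same, coeff_monomial] at hm
    split_ifs at hm with h
    · simp [h]
    · exact absurd rfl hm
  ε_range := by
    intro x
    rw [hI, Ideal.mem_span_singleton']
    constructor
    · rintro ⟨z, rfl⟩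
      exact ⟨z default, by simp [linearCombination_unique]⟩
    · rintro ⟨a, ha⟩
      refine ⟨single default a, ?_⟩
      ext1
      simp [← ha]
  d_graded := fun i g => isEmptyElim g
  d_minimal := fun i g => isEmptyElim g
  exact_zero := by
    rw [LinearMap.range_zero, LinearMap.ker_eq_bot']
    intro z hz
    rw [linearCombination_unique, smul_eq_zero, single_eq_zero, monomial_eq_zero] at hz
    ext1
    exact hz.resolve_right one_ne_zero
  exact := by
    intro i
    ext x
    simp [Subsingleton.elim x 0]

theorem principal_hasGen {I : Ideal (MvPolynomial σ K)} {s : σ →₀ ℕ}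
    {hI : I = Ideal.span {monomial s 1}} {i j : ℕ} :
    (principal s hI).HasGen i j ↔ i = 0 ∧ j = s.degree := by
  constructor
  · rintro ⟨g, rfl⟩
    cases i with
    | zero => exact ⟨rfl, rfl⟩
    | succ i => exact isEmptyElim (α := PrincipalGen (i + 1)) g
  · rintro ⟨rfl, rfl⟩
    exact ⟨(() : Unit), rfl⟩

/-- A family of types moved up by one index. -/
def Shift (ι : ℕ → Type) : ℕ → Type
  | 0 => Empty
  | i + 1 => ι i

variable {P Q S : Ideal (MvPolynomial σ K)}

/-- The degrees of the generators of a shifted resolution. -/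
def shiftDeg (C : Resolution S) : ∀ i, Shift C.ι i → ℕ
  | 0 => fun _ => 0
  | i + 1 => C.deg i

/-- The differentials of a shifted resolution. -/
noncomputable def shiftD (C : Resolution S) : ∀ i, (Shift C.ι (i + 1) →₀ MvPolynomial σ K)
    →ₗ[MvPolynomial σ K] (Shift C.ι i →₀ MvPolynomial σ K)
  | 0 => 0
  | i + 1 => C.d i

theorem shiftD_graded (C : Resolution S) :
    ∀ i, IsGraded (C.shiftDeg (i + 1)) (C.shiftDeg i) (C.shiftD i)
  | 0 => fun _ => zero_mem _
  | i + 1 => C.d_graded i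

theorem shiftD_minimal (C : Resolution S) :
    ∀ i g, C.shiftD i (single g 1) ∈ irrelevant K σ (Shift C.ι i)
  | 0 => fun _ => zero_mem _
  | i + 1 => C.d_minimal i

theorem shiftD_shiftD (C : Resolution S) : ∀ i x, C.shiftD i (C.shiftD (i + 1) x) = 0
  | 0 => fun _ => rfl
  | i + 1 => C.d_d i

/-- The augmentation of a shifted resolution. -/
noncomputable def shiftε (C : Resolution S) :
    (Shift C.ι 1 →₀ MvPolynomial σ K) →ₗ[MvPolynomial σ K] (Unit →₀ MvPolynomial σ K) := C.ε

theorem exists_of_shiftε_eq_zero (C : Resolution S) {x} (h : C.shiftε x = 0) :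
    ∃ z, C.shiftD 1 z = x := C.exists_of_ε_eq_zero h

theorem exists_of_shiftD_eq_zero (C : Resolution S) {i : ℕ} {x} (h : C.shiftD (i + 1) x = 0) :
    ∃ z, C.shiftD (i + 2) z = x := C.exists_of_d_eq_zero h

theorem exists_shift_lift (C : Resolution S) (A : Resolution P) (h : S ≤ P) :
    ∃ f : ∀ i, (Shift C.ι (i + 1) →₀ MvPolynomial σ K) →ₗ[MvPolynomial σ K]
        (A.ι i →₀ MvPolynomial σ K),
      (∀ i, IsGraded (C.shiftDeg (i + 1)) (A.deg i) (f i)) ∧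
      (∀ x, A.ε (f 0 x) = C.shiftε x) ∧
      ∀ i x, A.d i (f (i + 1) x) = f i (C.shiftD (i + 1) x) :=
  C.exists_lift A h

end Resolution

/-- Elements of a free module on a disjoint union of three bases, as triples. -/
noncomputable def tripleEquiv (K σ : Type*) [Field K] (ι κ μ : Type) :
    ((ι ⊕ (κ ⊕ μ)) →₀ MvPolynomial σ K) ≃ₗ[MvPolynomial σ K]
      (ι →₀ MvPolynomial σ K) × (κ →₀ MvPolynomial σ K) × (μ →₀ MvPolynomial σ K) :=
  (sumFinsuppLEquivProdFinsupp (MvPolynomial σ K)).trans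
    ((LinearEquiv.refl _ _).prodCongr (sumFinsuppLEquivProdFinsupp (MvPolynomial σ K)))

section triple

theorem tripleEquiv_single_inl (g : ι) (p : MvPolynomial σ K) :
    tripleEquiv K σ ι κ μ (single (Sum.inl g) p) = (single g p, 0, 0) := by
  simp only [tripleEquiv, LinearEquiv.trans_apply]
  refine Prod.ext ?_ (Prod.ext ?_ ?_) <;> ext1 x <;> simp [single_apply]

theorem tripleEquiv_single_inr_inl (g : κ) (p : MvPolynomial σ K) :
    tripleEquiv K σ ι κ μ (single (Sum.inr (Sum.inl g)) p) = (0, single g p, 0) := by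
  simp only [tripleEquiv, LinearEquiv.trans_apply]
  refine Prod.ext ?_ (Prod.ext ?_ ?_) <;> ext1 x <;> simp [single_apply]

theorem tripleEquiv_single_inr_inr (g : μ) (p : MvPolynomial σ K) :
    tripleEquiv K σ ι κ μ (single (Sum.inr (Sum.inr g)) p) = (0, 0, single g p) := by
  simp only [tripleEquiv, LinearEquiv.trans_apply]
  refine Prod.ext ?_ (Prod.ext ?_ ?_) <;> ext1 x <;> simp [single_apply]

variable {a : ι →₀ MvPolynomial σ K} {b : κ →₀ MvPolynomial σ K} {c : μ →₀ MvPolynomial σ K}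

theorem tripleEquiv_symm_inl (g : ι) :
    (tripleEquiv K σ ι κ μ).symm (a, b, c) (Sum.inl g) = a g := by
  simp [tripleEquiv]

theorem tripleEquiv_symm_inr_inl (g : κ) :
    (tripleEquiv K σ ι κ μ).symm (a, b, c) (Sum.inr (Sum.inl g)) = b g := by
  simp [tripleEquiv]

theorem tripleEquiv_symm_inr_inr (g : μ) :
    (tripleEquiv K σ ι κ μ).symm (a, b, c) (Sum.inr (Sum.inr g)) = c g := by
  simp [tripleEquiv]

theorem tripleEquiv_symm_mem_irrelevant (ha : a ∈ irrelevant K σ ι) (hb : b ∈ irrelevant K σ κ)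
    (hc : c ∈ irrelevant K σ μ) :
    (tripleEquiv K σ ι κ μ).symm (a, b, c) ∈ irrelevant K σ (ι ⊕ (κ ⊕ μ)) := by
  rintro (g | g | g)
  · rw [tripleEquiv_symm_inl]; exact ha g
  · rw [tripleEquiv_symm_inr_inl]; exact hb g
  · rw [tripleEquiv_symm_inr_inr]; exact hc g

theorem tripleEquiv_symm_mem {dι : ι → ℕ} {dκ : κ → ℕ} {dμ : μ → ℕ} {S : Set ℕ}
    (ha : a ∈ degreeSupported dι S) (hb : b ∈ degreeSupported dκ S)
    (hc : c ∈ degreeSupported dμ S) :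
    (tripleEquiv K σ ι κ μ).symm (a, b, c) ∈
      degreeSupported (Sum.elim dι (Sum.elim dκ dμ)) S := by
  rintro (g | g | g) e h
  · rw [tripleEquiv_symm_inl] at h
    exact ha g e h
  · rw [tripleEquiv_symm_inr_inl] at h
    exact hb g e h
  · rw [tripleEquiv_symm_inr_inr] at h
    exact hc g e h

end triple

theorem monomial_smul_mem_irrelevant {s : σ →₀ ℕ} (hs : s ≠ 0) (v : ι →₀ MvPolynomial σ K) :
    (monomial s (1 : K)) • v ∈ irrelevant K σ ι := by
  intro g
  simp [constantCoeff_monomial, hs]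

theorem mem_degreeSupported_add {deg : ι → ℕ} {k : ℕ} {v : ι →₀ MvPolynomial σ K}
    (hv : v ∈ degreeSupported deg {k}) (r : ℕ) :
    v ∈ degreeSupported (fun g => deg g + r) {k + r} := by
  intro g m h
  have := hv g m h
  simp only [Set.mem_singleton_iff] at this ⊢
  omega

namespace Resolution

variable {P Q S : Ideal (MvPolynomial σ K)}

/-- A minimal resolution of `s P + t Q` obtained as an iterated cone, when the intersection
of `s P` and `t Q` is `s t S`. -/
theorem exists_cone (A : Resolution P) (B : Resolution Q) (C : Resolution S) (hP : S ≤ P)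
    (hQ : S ≤ Q) {s t : σ →₀ ℕ} (hs : s ≠ 0) (ht : t ≠ 0)
    (h : ∀ p ∈ P, ∀ q ∈ Q, monomial s 1 * p = monomial t 1 * q →
      ∃ r ∈ S, p = monomial t 1 * r ∧ q = monomial s 1 * r)
    {T : Ideal (MvPolynomial σ K)}
    (hT : ∀ x, x ∈ T ↔ ∃ p ∈ P, ∃ q ∈ Q, x = monomial s 1 * p + monomial t 1 * q) :
    ∃ D : Resolution T, ∀ i j, D.HasGen i j ↔ (∃ k, A.HasGen i k ∧ j = k + s.degree) ∨
      (∃ k, B.HasGen i k ∧ j = k + t.degree) ∨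
      ∃ l k, C.HasGen l k ∧ i = l + 1 ∧ j = k + (s.degree + t.degree) := by
  obtain ⟨f, hf, hf0, hfd⟩ := C.exists_shift_lift A hP
  obtain ⟨f', hf', hf0', hfd'⟩ := C.exists_shift_lift B hQ
  set y : MvPolynomial σ K := monomial s 1 with hy
  set w : MvPolynomial σ K := monomial t 1 with hw
  have y0 : y ≠ 0 := by simp [hy]
  have w0 : w ≠ 0 := by simp [hw]
  let δ : ∀ i, ((A.ι (i + 1) →₀ MvPolynomial σ K) × (B.ι (i + 1) →₀ MvPolynomial σ K) ×
        (Shift C.ι (i + 1) →₀ MvPolynomial σ K)) →ₗ[MvPolynomial σ K]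
      (A.ι i →₀ MvPolynomial σ K) × (B.ι i →₀ MvPolynomial σ K) ×
        (Shift C.ι i →₀ MvPolynomial σ K) := fun i =>
    (A.d i ∘ₗ LinearMap.fst _ _ _ +
        w • (f i ∘ₗ LinearMap.snd _ _ _ ∘ₗ LinearMap.snd _ _ _)).prod
      ((B.d i ∘ₗ LinearMap.fst _ _ _ ∘ₗ LinearMap.snd _ _ _ -
          y • (f' i ∘ₗ LinearMap.snd _ _ _ ∘ₗ LinearMap.snd _ _ _)).prod
        (-(C.shiftD i ∘ₗ LinearMap.snd _ _ _ ∘ₗ LinearMap.snd _ _ _)))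
  let η : ((A.ι 0 →₀ MvPolynomial σ K) × (B.ι 0 →₀ MvPolynomial σ K) ×
      (Shift C.ι 0 →₀ MvPolynomial σ K)) →ₗ[MvPolynomial σ K] (Unit →₀ MvPolynomial σ K) :=
    y • (A.ε ∘ₗ LinearMap.fst _ _ _) + w • (B.ε ∘ₗ LinearMap.fst _ _ _ ∘ₗ LinearMap.snd _ _ _)
  have δ_apply : ∀ i a b c,
      δ i (a, b, c) = (A.d i a + w • f i c, B.d i b - y • f' i c, -C.shiftD i c) :=
    fun i a b c => rfl
  have η_apply : ∀ a b c, η (a, b, c) = y • A.ε a + w • B.ε b := fun a b c => rfl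
  let Φ : ∀ i, ((A.ι i ⊕ (B.ι i ⊕ Shift C.ι i)) →₀ MvPolynomial σ K) ≃ₗ[MvPolynomial σ K] _ :=
    fun i => tripleEquiv K σ (A.ι i) (B.ι i) (Shift C.ι i)
  have hδδ : ∀ i x, δ i (δ (i + 1) x) = 0 := by
    rintro i ⟨a, b, c⟩
    rw [δ_apply, δ_apply]
    refine Prod.ext ?_ (Prod.ext ?_ ?_)
    · simp [A.d_d, hfd]
    · simp [B.d_d, hfd']
    · simp [C.shiftD_shiftD]
  have hηδ : ∀ x, η (δ 0 x) = 0 := by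
    rintro ⟨a, b, c⟩
    rw [δ_apply, η_apply]
    simp only [map_add, map_sub, map_smul, A.ε_d, B.ε_d, zero_add, zero_sub, hf0, hf0']
    rw [smul_neg, smul_smul, smul_smul, mul_comm, add_neg_cancel]
  have hex0 : ∀ x, η x = 0 → ∃ z, δ 0 z = x := by
    rintro ⟨a, b, c⟩ hx
    rw [η_apply] at hx
    have hx' := DFunLike.congr_fun hx ()
    obtain ⟨r, hr, hr1, hr2⟩ := h (A.ε a ()) ((A.ε_range _).1 ⟨a, rfl⟩) (B.ε (-b) ())
      ((B.ε_range _).1 ⟨-b, rfl⟩) (by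
        simp only [map_neg, Finsupp.neg_apply, mul_neg]
        exact eq_neg_of_add_eq_zero_left hx')
    obtain ⟨z, hz⟩ : ∃ z, C.shiftε z = single () r :=
      (C.ε_range (single () r)).2 (by simpa using hr)
    obtain ⟨a', ha'⟩ := A.exists_of_ε_eq_zero (x := a - w • f 0 z) (by
      rw [map_sub, map_smul, hf0, hz, sub_eq_zero]
      ext1
      simpa using hr1)
    obtain ⟨b', hb'⟩ := B.exists_of_ε_eq_zero (x := b + y • f' 0 z) (by
      rw [map_add, map_smul, hf0', hz, ← neg_eq_iff_add_eq_zero, ← map_neg]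
      ext1
      simpa using hr2)
    refine ⟨(a', b', z), ?_⟩
    rw [δ_apply]
    refine Prod.ext ?_ (Prod.ext ?_ ?_)
    · rw [ha', sub_add_cancel]
    · rw [hb', add_sub_cancel_right]
    · ext g
      exact g.elim
  have hex : ∀ i x, δ i x = 0 → ∃ z, δ (i + 1) z = x := by
    rintro i ⟨a, b, c⟩ hx
    rw [δ_apply, Prod.mk_eq_zero, Prod.mk_eq_zero] at hx
    obtain ⟨h1, h2, h3⟩ := hx
    have hc : ∃ z, C.shiftD (i + 1) z = c := by
      cases i with
      | zero =>
        refine C.exists_of_shiftε_eq_zero ?_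
        have h4 := congrArg A.ε h1
        rw [map_add, A.ε_d, zero_add, map_smul, hf0, map_zero, smul_eq_zero] at h4
        exact h4.resolve_left w0
      | succ i => exact C.exists_of_shiftD_eq_zero (neg_eq_zero.1 h3)
    obtain ⟨z, rfl⟩ := hc
    obtain ⟨a', ha'⟩ := A.exists_of_d_eq_zero (x := a + w • f (i + 1) z) (by
      rw [map_add, map_smul, hfd, h1])
    obtain ⟨b', hb'⟩ := B.exists_of_d_eq_zero (x := b - y • f' (i + 1) z) (by
      rw [map_sub, map_smul, hfd', h2])
    refine ⟨(a', b', -z), ?_⟩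
    rw [δ_apply]
    refine Prod.ext ?_ (Prod.ext ?_ ?_)
    · simp [ha']
    · simp [hb']
    · simp
  let D : Resolution T :=
    { ι := fun i => A.ι i ⊕ (B.ι i ⊕ Shift C.ι i)
      deg := fun i => Sum.elim (fun g => A.deg i g + s.degree)
        (Sum.elim (fun g => B.deg i g + t.degree)
          (fun g => C.shiftDeg i g + (s.degree + t.degree)))
      ε := η ∘ₗ (Φ 0).toLinearMap
      d := fun i => (Φ i).symm.toLinearMap ∘ₗ δ i ∘ₗ (Φ (i + 1)).toLinearMap
      ε_graded := by
        rintro (g | g | g)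
        · simp only [LinearMap.comp_apply, LinearEquiv.coe_coe, Φ, tripleEquiv_single_inl, η_apply,
            map_zero, smul_zero, add_zero]
          exact monomial_smul_mem (A.ε_graded g) s 1
        · simp only [LinearMap.comp_apply, LinearEquiv.coe_coe, Φ, tripleEquiv_single_inr_inl,
            η_apply, map_zero, smul_zero, zero_add]
          exact monomial_smul_mem (B.ε_graded g) t 1
        · exact g.elim
      ε_range := by
        intro x
        rw [hT, LinearMap.mem_range]
        constructor
        · rintro ⟨z, rfl⟩
          rw [LinearMap.comp_apply, LinearEquiv.coe_coe]
          rcases Φ 0 z with ⟨a, b, c⟩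
          exact ⟨_, (A.ε_range _).1 ⟨a, rfl⟩, _, (B.ε_range _).1 ⟨b, rfl⟩, rfl⟩
        · rintro ⟨p, hp, q, hq, hx⟩
          obtain ⟨a, ha⟩ := (A.ε_range (single () p)).2 (by simpa using hp)
          obtain ⟨b, hb⟩ := (B.ε_range (single () q)).2 (by simpa using hq)
          refine ⟨(Φ 0).symm (a, b, 0), ?_⟩
          rw [LinearMap.comp_apply, LinearEquiv.coe_coe, LinearEquiv.apply_symm_apply, η_apply,
            ha, hb]
          ext1
          simp [hx]
      d_graded := by
        rintro i (g | g | g)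
        · simp only [LinearMap.comp_apply, LinearEquiv.coe_coe, Φ, tripleEquiv_single_inl, δ_apply,
            map_zero, smul_zero, add_zero, sub_zero, neg_zero]
          exact tripleEquiv_symm_mem (mem_degreeSupported_add (A.d_graded i g) _) (zero_mem _)
            (zero_mem _)
        · simp only [LinearMap.comp_apply, LinearEquiv.coe_coe, Φ, tripleEquiv_single_inr_inl,
            δ_apply, map_zero, smul_zero, add_zero, sub_zero, neg_zero]
          exact tripleEquiv_symm_mem (zero_mem _) (mem_degreeSupported_add (B.d_graded i g) _)
            (zero_mem _)
        · simp only [LinearMap.comp_apply, LinearEquiv.coe_coe, Φ, tripleEquiv_single_inr_inr,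
            δ_apply, map_zero, zero_add, zero_sub]
          refine tripleEquiv_symm_mem ?_ (neg_mem ?_)
            (neg_mem (mem_degreeSupported_add (C.shiftD_graded i g) _))
          · have := mem_degreeSupported_add (monomial_smul_mem (hf i g) t 1) s.degree
            rwa [add_assoc, add_comm t.degree] at this
          · have := mem_degreeSupported_add (monomial_smul_mem (hf' i g) s 1) t.degree
            rwa [add_assoc] at this
      d_minimal := by
        rintro i (g | g | g)
        · simp only [LinearMap.comp_apply, LinearEquiv.coe_coe, Φ, tripleEquiv_single_inl, δ_apply,
            map_zero, smul_zero, add_zero, sub_zero, neg_zero]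
          exact tripleEquiv_symm_mem_irrelevant (A.d_minimal i g) (zero_mem _) (zero_mem _)
        · simp only [LinearMap.comp_apply, LinearEquiv.coe_coe, Φ, tripleEquiv_single_inr_inl,
            δ_apply, map_zero, smul_zero, add_zero, sub_zero, neg_zero]
          exact tripleEquiv_symm_mem_irrelevant (zero_mem _) (B.d_minimal i g) (zero_mem _)
        · simp only [LinearMap.comp_apply, LinearEquiv.coe_coe, Φ, tripleEquiv_single_inr_inr,
            δ_apply, map_zero, zero_add, zero_sub]
          exact tripleEquiv_symm_mem_irrelevant (monomial_smul_mem_irrelevant ht _)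
            (neg_mem (monomial_smul_mem_irrelevant hs _)) (neg_mem (C.shiftD_minimal i g))
      exact_zero := by
        ext x
        simp only [LinearMap.mem_ker, LinearMap.mem_range, LinearMap.comp_apply,
          LinearEquiv.coe_coe]
        constructor
        · intro hx
          obtain ⟨z, hz⟩ := hex0 _ hx
          exact ⟨(Φ 1).symm z, by rw [LinearEquiv.apply_symm_apply, hz,
            LinearEquiv.symm_apply_apply]⟩
        · rintro ⟨z, rfl⟩
          rw [LinearEquiv.apply_symm_apply, hηδ]
      exact := by
        intro i
        ext x
        simp only [LinearMap.mem_ker, LinearMap.mem_range, LinearMap.comp_apply,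
          LinearEquiv.coe_coe, LinearEquiv.map_eq_zero_iff]
        constructor
        · intro hx
          obtain ⟨z, hz⟩ := hex _ _ hx
          exact ⟨(Φ (i + 2)).symm z, by rw [LinearEquiv.apply_symm_apply, hz,
            LinearEquiv.symm_apply_apply]⟩
        · rintro ⟨z, rfl⟩
          rw [LinearEquiv.apply_symm_apply, hδδ] }
  refine ⟨D, fun i j => ⟨?_, ?_⟩⟩
  · rintro ⟨g | g | g, rfl⟩
    · exact Or.inl ⟨_, ⟨g, rfl⟩, rfl⟩
    · exact Or.inr (Or.inl ⟨_, ⟨g, rfl⟩, rfl⟩)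
    · cases i with
      | zero => exact g.elim
      | succ i => exact Or.inr (Or.inr ⟨i, _, ⟨g, rfl⟩, rfl, rfl⟩)
  · rintro (⟨_, ⟨g, rfl⟩, rfl⟩ | ⟨_, ⟨g, rfl⟩, rfl⟩ | ⟨l, _, ⟨g, rfl⟩, rfl, rfl⟩)
    · exact ⟨Sum.inl g, rfl⟩
    · exact ⟨Sum.inr (Sum.inl g), rfl⟩
    · exact ⟨Sum.inr (Sum.inr g), rfl⟩

end Resolution

end GradedFree

/-- View a minimal free resolution as one with abstract generators. -/
noncomputable def MinimalFreeResolution.toResolution {K : Type*} [Field K] {σ : Type*}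
    {I : Ideal (MvPolynomial σ K)} (F : MinimalFreeResolution I) : GradedFree.Resolution I where
  ι := fun i => Σ j : ℕ, Fin (F.β i j)
  deg := fun _ g => g.1
  ε := Finsupp.lsingle () ∘ₗ F.ε
  d := F.d
  ε_graded := by
    intro g u m hm
    have := F.ε_homog g
    rw [MvPolynomial.mem_homogeneousSubmodule] at this
    rw [LinearMap.comp_apply, Finsupp.lsingle_apply, Finsupp.single_eq_same] at hm
    have h : m.degree = g.1 := by
      rw [Finsupp.degree_eq_weight_one]
      exact this hm
    simpa using h
  ε_range := by
    intro x
    refine Iff.trans ?_ (SetLike.ext_iff.1 F.ε_range (x ()))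
    constructor
    · rintro ⟨z, rfl⟩
      exact ⟨z, by simp⟩
    · rintro ⟨z, hz⟩
      refine ⟨z, ?_⟩
      ext1
      simpa using hz
  d_graded := by
    intro i g g' m hm
    have hlt : g'.1 < g.1 := by
      by_contra h
      rw [F.d_minimal i g g' (not_lt.1 h)] at hm
      simp at hm
    have := F.d_homog i g g'
    rw [MvPolynomial.mem_homogeneousSubmodule] at this
    have h : m.degree = g.1 - g'.1 := by
      rw [Finsupp.degree_eq_weight_one]
      exact this hm
    change m.degree + g'.1 = g.1
    omega
  d_minimal := by
    intro i g g'
    rcases le_or_gt g.1 g'.1 with h | h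
    · rw [F.d_minimal i g g' h, map_zero]
    · have := F.d_homog i g g'
      rw [MvPolynomial.mem_homogeneousSubmodule] at this
      rw [MvPolynomial.constantCoeff_eq]
      refine this.coeff_eq_zero ?_
      rw [map_zero]
      omega
  exact_zero := by
    rw [← F.exact_at_zero]
    ext x
    simp
  exact := F.exact

theorem MinimalFreeResolution.hasGen_toResolution {K : Type*} [Field K] {σ : Type*}
    {I : Ideal (MvPolynomial σ K)} (F : MinimalFreeResolution I) {i j : ℕ} :
    F.toResolution.HasGen i j ↔ F.β i j ≠ 0 := by
  constructor
  · rintro ⟨⟨k, a⟩, rfl⟩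
    exact (Nat.pos_of_ne_zero (by rintro h; exact (Fin.cast h a).elim0)).ne'
  · intro h
    exact ⟨⟨j, ⟨0, Nat.pos_of_ne_zero h⟩⟩, rfl⟩

namespace Domino

open MvPolynomial Finsupp

/-- The exponent vectors of the tilings of the 2×m board, for the labelling of the 2×n board. -/
def exponents (n : ℕ) : ℕ → Set (ℕ ⊕ ℕ →₀ ℕ)
  | 0 => {0}
  | 1 => {single (Sum.inr 1) 1}
  | m + 2 => (· + single (Sum.inr (m + 2)) 1) '' exponents n (m + 1) ∪
      (· + (single (Sum.inl (m + 1)) 1 + single (Sum.inl (n + m)) 1)) '' exponents n m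

/-- The exponent vector of a tiling. -/
noncomputable def tilingExponent (n : ℕ) (T : Finset (Finset (ℕ × ℕ))) : ℕ ⊕ ℕ →₀ ℕ :=
  ∑ d ∈ T, single (dominoVar n d) 1

theorem dominoMonomial_eq (K : Type*) [Field K] (n : ℕ) (T : Finset (Finset (ℕ × ℕ))) :
    dominoMonomial K n T = monomial (tilingExponent n T) 1 := by
  rw [dominoMonomial, tilingExponent, monomial_sum_one]
  rfl

theorem mem_Vert {k : ℕ} {c : ℕ × ℕ} : c ∈ Vert k ↔ c.1 < 2 ∧ c.2 = k := by
  obtain ⟨a, b⟩ := c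
  simp only [Vert, Finset.mem_insert, Finset.mem_singleton, Prod.mk.injEq]
  omega

theorem mem_Horiz {i k : ℕ} {c : ℕ × ℕ} : c ∈ Horiz i k ↔ c.1 = i ∧ (c.2 = k ∨ c.2 = k + 1) := by
  obtain ⟨a, b⟩ := c
  simp only [Horiz, Finset.mem_insert, Finset.mem_singleton, Prod.mk.injEq]
  omega

theorem Vert_injective : Function.Injective Vert := by
  intro k l h
  have : (0, k) ∈ Vert l := h ▸ mem_Vert.2 ⟨by omega, rfl⟩
  exact (mem_Vert.1 this).2

theorem Horiz_ne_Vert (i k l : ℕ) : Horiz i k ≠ Vert l := by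
  intro h
  have h1 : (i, k) ∈ Vert l := h ▸ mem_Horiz.2 ⟨rfl, Or.inl rfl⟩
  have h2 : (i, k + 1) ∈ Vert l := h ▸ mem_Horiz.2 ⟨rfl, Or.inr rfl⟩
  rw [mem_Vert] at h1 h2
  omega

theorem Horiz_eq_iff {i k j l : ℕ} : Horiz i k = Horiz j l ↔ i = j ∧ k = l := by
  constructor
  · intro h
    have h1 : (i, k) ∈ Horiz j l := h ▸ mem_Horiz.2 ⟨rfl, Or.inl rfl⟩
    have h2 : (i, k + 1) ∈ Horiz j l := h ▸ mem_Horiz.2 ⟨rfl, Or.inr rfl⟩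
    rw [mem_Horiz] at h1 h2
    omega
  · rintro ⟨rfl, rfl⟩
    rfl

theorem dominoVar_Vert (n k : ℕ) : dominoVar n (Vert k) = Sum.inr (k + 1) := by
  have h : ∃ l, Vert k = Vert l := ⟨k, rfl⟩
  rw [dominoVar, dif_pos h, ← Vert_injective h.choose_spec]

theorem dominoVar_Horiz_zero (n k : ℕ) : dominoVar n (Horiz 0 k) = Sum.inl (k + 1) := by
  have h : ∃ l, Horiz 0 k = Horiz 0 l := ⟨k, rfl⟩
  rw [dominoVar, dif_neg (by rintro ⟨l, hl⟩; exact Horiz_ne_Vert _ _ _ hl), dif_pos h,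
    ← (Horiz_eq_iff.1 h.choose_spec).2]

theorem dominoVar_Horiz_one (n k : ℕ) : dominoVar n (Horiz 1 k) = Sum.inl (n + k) := by
  have h : ∃ l, Horiz 1 k = Horiz 1 l := ⟨k, rfl⟩
  rw [dominoVar, dif_neg (by rintro ⟨l, hl⟩; exact Horiz_ne_Vert _ _ _ hl),
    dif_neg (by rintro ⟨l, hl⟩; exact absurd (Horiz_eq_iff.1 hl).1 one_ne_zero), dif_pos h,
    ← (Horiz_eq_iff.1 h.choose_spec).2]

/-- A tiling ends with a vertical domino or with two horizontal dominoes. -/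
theorem IsTiling.last {m : ℕ} {T : Finset (Finset (ℕ × ℕ))} (hT : IsTiling (m + 1) T) :
    Vert m ∈ T ∨ ∃ k, m = k + 1 ∧ Horiz 0 k ∈ T ∧ Horiz 1 k ∈ T := by
  obtain ⟨h1, h2, h3⟩ := hT
  have cover : ∀ i < 2, ∃ d ∈ T, (i, m) ∈ d ∧ (d = Vert m ∨ ∃ k, m = k + 1 ∧ d = Horiz i k) := by
    intro i hi
    obtain ⟨d, hd, hmem⟩ := (h2 (i, m)).1 ⟨hi, by simp⟩
    refine ⟨d, hd, hmem, ?_⟩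
    rcases h1 d hd with ⟨k, hk, rfl⟩ | ⟨j, hj, k, hk, rfl⟩
    · left
      have h : m = k := (mem_Vert.1 hmem).2
      rw [h]
    · right
      have := mem_Horiz.1 hmem
      simp only at this
      refine ⟨k, by omega, ?_⟩
      rw [this.1]
  obtain ⟨d, hd, -, rfl | ⟨k, rfl, rfl⟩⟩ := cover 0 (by omega)
  · exact Or.inl hd
  obtain ⟨e, he, -, rfl | ⟨l, hl, rfl⟩⟩ := cover 1 (by omega)
  · exact Or.inl he
  · obtain rfl : k = l := by omega
    exact Or.inr ⟨k, rfl, hd, he⟩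

theorem IsTiling.erase_Vert {m : ℕ} {T : Finset (Finset (ℕ × ℕ))} (hT : IsTiling (m + 1) T)
    (h : Vert m ∈ T) : IsTiling m (T.erase (Vert m)) := by
  obtain ⟨h1, h2, h3⟩ := hT
  have avoid : ∀ d ∈ T, d ≠ Vert m → ∀ c ∈ d, c.2 < m := by
    intro d hd hne c hc
    obtain ⟨h4, h5⟩ := (h2 c).2 ⟨d, hd, hc⟩
    by_contra h6
    exact Finset.disjoint_left.1 (h3 d hd _ h hne) hc (mem_Vert.2 ⟨h4, by omega⟩)
  refine ⟨fun d hd => ?_, fun c => ⟨fun hc => ?_, ?_⟩, fun d hd e he => ?_⟩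
  · rw [Finset.mem_erase] at hd
    rcases h1 d hd.2 with ⟨k, hk, rfl⟩ | ⟨j, hj, k, hk, rfl⟩
    · exact Or.inl ⟨k, avoid _ hd.2 hd.1 (0, k) (mem_Vert.2 ⟨by simp, rfl⟩), rfl⟩
    · exact Or.inr ⟨j, hj, k, avoid _ hd.2 hd.1 (j, k + 1) (mem_Horiz.2 ⟨rfl, Or.inr rfl⟩), rfl⟩
  · obtain ⟨d, hd, hcd⟩ := (h2 c).1 ⟨hc.1, by omega⟩
    refine ⟨d, Finset.mem_erase.2 ⟨?_, hd⟩, hcd⟩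
    rintro rfl
    have := (mem_Vert.1 hcd).2
    omega
  · rintro ⟨d, hd, hcd⟩
    rw [Finset.mem_erase] at hd
    exact ⟨((h2 c).2 ⟨d, hd.2, hcd⟩).1, avoid d hd.2 hd.1 c hcd⟩
  · exact h3 d (Finset.mem_of_mem_erase hd) e (Finset.mem_of_mem_erase he)

theorem IsTiling.erase_Horiz {m : ℕ} {T : Finset (Finset (ℕ × ℕ))} (hT : IsTiling (m + 2) T)
    (h : Horiz 0 m ∈ T) (h' : Horiz 1 m ∈ T) :
    IsTiling m ((T.erase (Horiz 1 m)).erase (Horiz 0 m)) := by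
  obtain ⟨h1, h2, h3⟩ := hT
  have avoid : ∀ d ∈ T, d ≠ Horiz 0 m → d ≠ Horiz 1 m → ∀ c ∈ d, c.2 < m := by
    intro d hd hne hne' c hc
    obtain ⟨h4, h5⟩ := (h2 c).2 ⟨d, hd, hc⟩
    by_contra h6
    rcases (by omega : c.1 = 0 ∨ c.1 = 1) with h7 | h7
    · exact Finset.disjoint_left.1 (h3 d hd _ h hne) hc (mem_Horiz.2 ⟨h7, by omega⟩)
    · exact Finset.disjoint_left.1 (h3 d hd _ h' hne') hc (mem_Horiz.2 ⟨h7, by omega⟩)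
  refine ⟨fun d hd => ?_, fun c => ⟨fun hc => ?_, ?_⟩, fun d hd e he => ?_⟩
  · rw [Finset.mem_erase, Finset.mem_erase] at hd
    obtain ⟨hd0, hd1, hd⟩ := hd
    rcases h1 d hd with ⟨k, hk, rfl⟩ | ⟨j, hj, k, hk, rfl⟩
    · exact Or.inl ⟨k, avoid _ hd hd0 hd1 (0, k) (mem_Vert.2 ⟨by simp, rfl⟩), rfl⟩
    · exact Or.inr ⟨j, hj, k, avoid _ hd hd0 hd1 (j, k + 1) (mem_Horiz.2 ⟨rfl, Or.inr rfl⟩), rfl⟩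
  · obtain ⟨d, hd, hcd⟩ := (h2 c).1 ⟨hc.1, by omega⟩
    refine ⟨d, Finset.mem_erase.2 ⟨?_, Finset.mem_erase.2 ⟨?_, hd⟩⟩, hcd⟩ <;>
    · rintro rfl
      have := (mem_Horiz.1 hcd).2
      omega
  · rintro ⟨d, hd, hcd⟩
    rw [Finset.mem_erase, Finset.mem_erase] at hd
    exact ⟨((h2 c).2 ⟨d, hd.2.2, hcd⟩).1, avoid d hd.2.2 hd.1 hd.2.1 c hcd⟩
  · exact h3 d (Finset.mem_of_mem_erase (Finset.mem_of_mem_erase hd)) e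
      (Finset.mem_of_mem_erase (Finset.mem_of_mem_erase he))

theorem IsTiling.insert_Vert {m : ℕ} {T : Finset (Finset (ℕ × ℕ))} (hT : IsTiling m T) :
    Vert m ∉ T ∧ IsTiling (m + 1) (insert (Vert m) T) := by
  obtain ⟨h1, h2, h3⟩ := hT
  have disj : ∀ d ∈ T, Disjoint d (Vert m) := by
    intro d hd
    rw [Finset.disjoint_left]
    intro c hc hc'
    have h4 := (h2 c).2 ⟨d, hd, hc⟩
    have h5 := mem_Vert.1 hc'
    omega
  refine ⟨fun h => ?_, fun d hd => ?_, fun c => ?_, fun d hd e he hne => ?_⟩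
  · have := (h2 (0, m)).2 ⟨_, h, mem_Vert.2 ⟨by simp, rfl⟩⟩
    simp at this
  · rcases Finset.mem_insert.1 hd with rfl | hd
    · exact Or.inl ⟨m, by omega, rfl⟩
    · rcases h1 d hd with ⟨k, hk, rfl⟩ | ⟨j, hj, k, hk, rfl⟩
      · exact Or.inl ⟨k, by omega, rfl⟩
      · exact Or.inr ⟨j, hj, k, by omega, rfl⟩
  · simp only [Finset.exists_mem_insert, ← h2, mem_Vert]
    omega
  · rcases Finset.mem_insert.1 hd with rfl | hd <;> rcases Finset.mem_insert.1 he with rfl | he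
    · exact absurd rfl hne
    · exact (disj e he).symm
    · exact disj d hd
    · exact h3 d hd e he hne

theorem IsTiling.insert_Horiz {m : ℕ} {T : Finset (Finset (ℕ × ℕ))} (hT : IsTiling m T) :
    Horiz 1 m ∉ T ∧ Horiz 0 m ∉ insert (Horiz 1 m) T ∧
      IsTiling (m + 2) (insert (Horiz 0 m) (insert (Horiz 1 m) T)) := by
  obtain ⟨h1, h2, h3⟩ := hT
  have disj : ∀ i, ∀ d ∈ T, Disjoint d (Horiz i m) := by
    intro i d hd
    rw [Finset.disjoint_left]
    intro c hc hc'
    have h4 := (h2 c).2 ⟨d, hd, hc⟩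
    have h5 := mem_Horiz.1 hc'
    omega
  have notMem : ∀ i, Horiz i m ∉ T := by
    intro i h
    have := (h2 (i, m)).2 ⟨_, h, mem_Horiz.2 ⟨rfl, Or.inl rfl⟩⟩
    simp at this
  have disj' : Disjoint (Horiz 0 m) (Horiz 1 m) := by
    rw [Finset.disjoint_left]
    intro c hc hc'
    rw [mem_Horiz] at hc hc'
    omega
  refine ⟨notMem 1, ?_, fun d hd => ?_, fun c => ?_, fun d hd e he hne => ?_⟩
  · rw [Finset.mem_insert, Horiz_eq_iff]
    rintro (h | h)
    · omega
    · exact notMem 0 h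
  · rcases Finset.mem_insert.1 hd with rfl | hd
    · exact Or.inr ⟨0, by omega, m, by omega, rfl⟩
    rcases Finset.mem_insert.1 hd with rfl | hd
    · exact Or.inr ⟨1, by omega, m, by omega, rfl⟩
    · rcases h1 d hd with ⟨k, hk, rfl⟩ | ⟨j, hj, k, hk, rfl⟩
      · exact Or.inl ⟨k, by omega, rfl⟩
      · exact Or.inr ⟨j, hj, k, by omega, rfl⟩
  · simp only [Finset.exists_mem_insert, ← h2, mem_Horiz]
    omega
  · rw [Finset.mem_insert, Finset.mem_insert] at hd he
    rcases hd with rfl | rfl | hd <;> rcases he with rfl | rfl | he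
    · exact absurd rfl hne
    · exact disj'
    · exact (disj _ e he).symm
    · exact disj'.symm
    · exact absurd rfl hne
    · exact (disj _ e he).symm
    · exact disj _ d hd
    · exact disj _ d hd
    · exact h3 d hd e he hne

theorem isTiling_zero {T : Finset (Finset (ℕ × ℕ))} : IsTiling 0 T ↔ T = ∅ := by
  constructor
  · rintro ⟨h1, -, -⟩
    refine Finset.eq_empty_of_forall_notMem fun d hd => ?_
    rcases h1 d hd with ⟨k, hk, -⟩ | ⟨j, hj, k, hk, -⟩ <;> omega
  · rintro rfl
    exact ⟨by simp, by simp, by simp⟩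

theorem tilingExponent_insert_Vert {n m : ℕ} {T : Finset (Finset (ℕ × ℕ))} (h : Vert m ∉ T) :
    tilingExponent n (insert (Vert m) T) =
      tilingExponent n T + single (Sum.inr (m + 1)) 1 := by
  rw [tilingExponent, Finset.sum_insert h, dominoVar_Vert, add_comm, tilingExponent]

theorem tilingExponent_insert_Horiz {n m : ℕ} {T : Finset (Finset (ℕ × ℕ))}
    (h : Horiz 1 m ∉ T) (h' : Horiz 0 m ∉ insert (Horiz 1 m) T) :
    tilingExponent n (insert (Horiz 0 m) (insert (Horiz 1 m) T)) =
      tilingExponent n T + (single (Sum.inl (m + 1)) 1 + single (Sum.inl (n + m)) 1) := by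
  rw [tilingExponent, Finset.sum_insert h', Finset.sum_insert h, dominoVar_Horiz_zero,
    dominoVar_Horiz_one, tilingExponent]
  abel

theorem image_tilingExponent (n : ℕ) (m : ℕ) :
    tilingExponent n '' {T | IsTiling m T} = exponents n m := by
  induction m using Nat.twoStepInduction with
  | zero =>
    simp only [isTiling_zero, Set.ofPred_eq_eq_singleton, Set.image_singleton, exponents]
    simp [tilingExponent]
  | one =>
    have h0 : tilingExponent n {Vert 0} = single (Sum.inr 1) 1 := by
      rw [tilingExponent, Finset.sum_singleton, dominoVar_Vert]
    ext a
    simp only [exponents, Set.mem_image, Set.mem_ofPred_eq, Set.mem_singleton_iff]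
    constructor
    · rintro ⟨T, hT, rfl⟩
      rcases IsTiling.last hT with h | ⟨k, hk, -⟩
      · have h1 := isTiling_zero.1 (IsTiling.erase_Vert hT h)
        rw [← Finset.insert_erase h, h1]
        exact h0
      · omega
    · rintro rfl
      exact ⟨_, (IsTiling.insert_Vert (isTiling_zero.2 rfl)).2, h0⟩
  | more m ih1 ih2 =>
    rw [exponents, ← ih1, ← ih2]
    ext a
    constructor
    · rintro ⟨T, hT, rfl⟩
      rcases IsTiling.last hT with h | ⟨k, hk, h, h'⟩
      · refine Or.inl ⟨_, ⟨_, IsTiling.erase_Vert hT h, rfl⟩, ?_⟩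
        dsimp only
        rw [← tilingExponent_insert_Vert (Finset.notMem_erase _ _), Finset.insert_erase h]
      · obtain rfl : m = k := by omega
        have h0 : Horiz 0 m ∈ T.erase (Horiz 1 m) :=
          Finset.mem_erase.2 ⟨by rw [Ne, Horiz_eq_iff]; omega, h⟩
        refine Or.inr ⟨_, ⟨_, IsTiling.erase_Horiz hT h h', rfl⟩, ?_⟩
        dsimp only
        have ht := IsTiling.insert_Horiz (IsTiling.erase_Horiz hT h h')
        rw [← tilingExponent_insert_Horiz ht.1 ht.2.1, Finset.insert_comm,
          Finset.insert_erase h0, Finset.insert_erase h']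
    · rintro (⟨_, ⟨T, hT, rfl⟩, rfl⟩ | ⟨_, ⟨T, hT, rfl⟩, rfl⟩)
      · have ht := IsTiling.insert_Vert hT
        exact ⟨_, ht.2, tilingExponent_insert_Vert ht.1⟩
      · have ht := IsTiling.insert_Horiz hT
        exact ⟨_, ht.2.2, tilingExponent_insert_Horiz ht.1 ht.2.1⟩


theorem dominoIdealIn_eq (K : Type*) [Field K] (n m : ℕ) :
    dominoIdealIn K n m = Ideal.span ((fun a => monomial a (1 : K)) '' exponents n m) := by
  rw [dominoIdealIn, ← image_tilingExponent, Set.image_image]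
  congr 1
  ext p
  simp only [← dominoMonomial_eq, Set.mem_image, Set.mem_ofPred_eq, eq_comm]

theorem apply_eq_zero_of_mem_exponents {n m : ℕ} {v : ℕ ⊕ ℕ} (hr : ∀ k < m, v ≠ Sum.inr (k + 1))
    (hl : ∀ k, k + 1 < m → v ≠ Sum.inl (k + 1) ∧ v ≠ Sum.inl (n + k)) {a : ℕ ⊕ ℕ →₀ ℕ}
    (ha : a ∈ exponents n m) : a v = 0 := by
  induction m using Nat.twoStepInduction generalizing a with
  | zero =>
    rw [exponents, Set.mem_singleton_iff] at ha
    rw [ha, Finsupp.coe_zero, Pi.zero_apply]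
  | one =>
    rw [exponents, Set.mem_singleton_iff] at ha
    rw [ha, single_eq_of_ne (hr 0 one_pos)]
  | more m ih1 ih2 =>
    rcases ha with ⟨b, hb, rfl⟩ | ⟨b, hb, rfl⟩
    · have := ih2 (fun k hk => hr k (by omega)) (fun k hk => hl k (by omega)) hb
      simp only [Finsupp.add_apply, this, single_eq_of_ne (hr (m + 1) (by omega)), add_zero]
    · have := ih1 (fun k hk => hr k (by omega)) (fun k hk => hl k (by omega)) hb
      have hm := hl m (by omega)
      simp only [Finsupp.add_apply, this, single_eq_of_ne hm.1, single_eq_of_ne hm.2, add_zero]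

variable {K : Type*} [Field K] {σ : Type*}

theorem mem_span_of_X_mul_mem {A : Set (σ →₀ ℕ)} {v : σ} (h : ∀ a ∈ A, a v = 0)
    {p : MvPolynomial σ K}
    (hp : X v * p ∈ Ideal.span ((fun a => monomial a (1 : K)) '' A)) :
    p ∈ Ideal.span ((fun a => monomial a (1 : K)) '' A) := by
  rw [mem_ideal_span_monomial_image] at hp ⊢
  intro x hx
  obtain ⟨a, ha, hle⟩ := hp (single v 1 + x) (by
    rwa [MvPolynomial.mem_support_iff, coeff_X_mul, ← MvPolynomial.mem_support_iff])
  refine ⟨a, ha, fun w => ?_⟩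
  by_cases hw : w = v
  · rw [hw, h a ha]
    exact Nat.zero_le _
  · simpa [single_eq_of_ne hw] using hle w

open scoped Pointwise in
theorem mem_span_translate_union {A B : Set (σ →₀ ℕ)} {s t : σ →₀ ℕ} {x : MvPolynomial σ K} :
    x ∈ Ideal.span ((fun a => monomial a (1 : K)) '' ((· + s) '' A ∪ (· + t) '' B)) ↔
      ∃ p ∈ Ideal.span ((fun a => monomial a (1 : K)) '' A),
      ∃ q ∈ Ideal.span ((fun a => monomial a (1 : K)) '' B),
        x = monomial s 1 * p + monomial t 1 * q := by
  have translate : ∀ (A : Set (σ →₀ ℕ)) (s : σ →₀ ℕ),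
      Ideal.span ((fun a => monomial a (1 : K)) '' ((· + s) '' A)) =
        Ideal.span {monomial s (1 : K)} * Ideal.span ((fun a => monomial a (1 : K)) '' A) := by
    intro A s
    rw [Ideal.span_mul_span', Set.singleton_mul, Set.image_image, Set.image_image]
    simp only [monomial_mul, one_mul, add_comm]
  rw [Set.image_union, Ideal.span_union, translate, translate, Submodule.mem_sup]
  simp only [Ideal.mem_span_singleton_mul]
  constructor
  · rintro ⟨_, ⟨p, hp, rfl⟩, _, ⟨q, hq, rfl⟩, rfl⟩
    exact ⟨p, hp, q, hq, rfl⟩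
  · rintro ⟨p, hp, q, hq, rfl⟩
    exact ⟨_, ⟨p, hp, rfl⟩, _, ⟨q, hq, rfl⟩, rfl⟩

theorem monomial_single_add_single (v w : σ) :
    monomial (single v 1 + single w 1) (1 : K) = X v * X w := by
  rw [X, X, monomial_mul, one_mul]

/-- The exponent of the vertical domino in the last column of the 2×(m+2) board. -/
noncomputable def vertExponent (m : ℕ) : ℕ ⊕ ℕ →₀ ℕ := single (Sum.inr (m + 2)) 1

/-- The exponent of the horizontal dominoes in the last columns of the 2×(m+2) board. -/
noncomputable def horizExponent (n m : ℕ) : ℕ ⊕ ℕ →₀ ℕ :=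
  single (Sum.inl (m + 1)) 1 + single (Sum.inl (n + m)) 1

theorem degree_vertExponent (m : ℕ) : (vertExponent m).degree = 1 := degree_single _ _

theorem degree_horizExponent (n m : ℕ) : (horizExponent n m).degree = 2 := by
  rw [horizExponent, map_add, degree_single, degree_single]

theorem mem_dominoIdealIn_add_two {n m : ℕ} {x : MvPolynomial (ℕ ⊕ ℕ) K} :
    x ∈ dominoIdealIn K n (m + 2) ↔
      ∃ p ∈ dominoIdealIn K n (m + 1), ∃ q ∈ dominoIdealIn K n m,
        x = monomial (vertExponent m) 1 * p + monomial (horizExponent n m) 1 * q := by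
  simp only [dominoIdealIn_eq]
  exact mem_span_translate_union

theorem mem_of_vert_mul_mem {n m : ℕ} {p : MvPolynomial (ℕ ⊕ ℕ) K}
    (hp : monomial (vertExponent m) 1 * p ∈ dominoIdealIn K n m) : p ∈ dominoIdealIn K n m := by
  rw [dominoIdealIn_eq] at hp ⊢
  refine mem_span_of_X_mul_mem (fun a => apply_eq_zero_of_mem_exponents ?_ ?_) hp
  · intro k hk h
    have := Sum.inr_injective h
    omega
  · exact fun k hk => ⟨Sum.inr_ne_inl, Sum.inr_ne_inl⟩

theorem mem_of_horiz_mul_mem {n m : ℕ} (hmn : m + 2 ≤ n) {p : MvPolynomial (ℕ ⊕ ℕ) K}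
    (hp : monomial (horizExponent n m) 1 * p ∈ dominoIdealIn K n (m + 1)) :
    p ∈ dominoIdealIn K n (m + 1) := by
  rw [dominoIdealIn_eq, horizExponent, monomial_single_add_single, mul_assoc] at hp
  rw [dominoIdealIn_eq]
  refine mem_span_of_X_mul_mem (fun a => apply_eq_zero_of_mem_exponents ?_ ?_)
    (mem_span_of_X_mul_mem (fun a => apply_eq_zero_of_mem_exponents ?_ ?_) hp)
  · exact fun k hk => Sum.inl_ne_inr
  · intro k hk
    simp only [Ne, Sum.inl.injEq]
    omega
  · exact fun k hk => Sum.inl_ne_inr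
  · intro k hk
    simp only [Ne, Sum.inl.injEq]
    omega

theorem mem_inf_add_two {n m : ℕ} (hmn : m + 2 ≤ n) {x : MvPolynomial (ℕ ⊕ ℕ) K} :
    x ∈ dominoIdealIn K n (m + 2) ⊓ dominoIdealIn K n (m + 1) ↔
      ∃ p ∈ dominoIdealIn K n (m + 1), ∃ q ∈ dominoIdealIn K n (m + 1) ⊓ dominoIdealIn K n m,
        x = monomial (vertExponent m) 1 * p + monomial (horizExponent n m) 1 * q := by
  constructor
  · rintro ⟨hx, hx'⟩
    obtain ⟨p, hp, q, hq, rfl⟩ := mem_dominoIdealIn_add_two.1 hx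
    refine ⟨p, hp, q, ⟨mem_of_horiz_mul_mem hmn ?_, hq⟩, rfl⟩
    exact (Ideal.add_mem_iff_right _ (Ideal.mul_mem_left _ _ hp)).1 hx'
  · rintro ⟨p, hp, q, hq, rfl⟩
    exact ⟨mem_dominoIdealIn_add_two.2 ⟨p, hp, q, hq.2, rfl⟩,
      add_mem (Ideal.mul_mem_left _ _ hp) (Ideal.mul_mem_left _ _ hq.1)⟩

theorem exists_of_vert_mul_eq_horiz_mul {n m : ℕ} (hmn : m + 2 ≤ n)
    {p q : MvPolynomial (ℕ ⊕ ℕ) K} (hp : p ∈ dominoIdealIn K n (m + 1))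
    (hq : q ∈ dominoIdealIn K n m)
    (h : monomial (vertExponent m) 1 * p = monomial (horizExponent n m) 1 * q) :
    ∃ r ∈ dominoIdealIn K n (m + 1) ⊓ dominoIdealIn K n m,
      p = monomial (horizExponent n m) 1 * r ∧ q = monomial (vertExponent m) 1 * r := by
  have hprime : Prime (monomial (vertExponent m) 1 : MvPolynomial (ℕ ⊕ ℕ) K) :=
    X_prime
  have hdvd : ¬ (monomial (vertExponent m) 1 : MvPolynomial (ℕ ⊕ ℕ) K) ∣
      monomial (horizExponent n m) 1 := by
    rw [horizExponent, monomial_single_add_single]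
    intro h
    rcases hprime.dvd_or_dvd h with h | h <;> exact Sum.inr_ne_inl (X_dvd_X.1 h)
  obtain ⟨r, rfl⟩ := (hprime.dvd_or_dvd (Dvd.intro _ h)).resolve_left hdvd
  have hr : p = monomial (horizExponent n m) 1 * r := by
    apply mul_left_cancel₀ hprime.ne_zero
    rw [h]
    ring
  exact ⟨r, ⟨mem_of_horiz_mul_mem hmn (hr ▸ hp), mem_of_vert_mul_mem hq⟩, hr, rfl⟩

open GradedFree in
/-- Resolutions of two consecutive domino ideals and of their intersection. -/
theorem exists_resolutions (K : Type*) [Field K] (n m : ℕ) (hmn : m + 1 ≤ n) :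
    ∃ (A : Resolution (dominoIdealIn K n m)) (B : Resolution (dominoIdealIn K n (m + 1)))
      (C : Resolution (dominoIdealIn K n (m + 1) ⊓ dominoIdealIn K n m)),
      (∀ i j, A.HasGen i j → j ≤ i + 2 * m) ∧ (∀ i j, B.HasGen i j → j ≤ i + 2 * m + 1) ∧
      (∀ i j, C.HasGen i j → j ≤ i + 2 * m + 1) ∧ B.HasGen m (3 * m + 1) ∧
      C.HasGen m (3 * m + 1) := by
  induction m with
  | zero =>
    have h0 : dominoIdealIn K n 0 = Ideal.span {monomial 0 1} := by
      rw [dominoIdealIn_eq, exponents, Set.image_singleton]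
    have h1 : dominoIdealIn K n 1 = Ideal.span {monomial (single (Sum.inr 1) 1) 1} := by
      rw [dominoIdealIn_eq, exponents, Set.image_singleton]
    have h2 : dominoIdealIn K n 1 ⊓ dominoIdealIn K n 0 =
        Ideal.span {monomial (single (Sum.inr 1) 1) 1} := by
      rw [h0, monomial_zero', C_1, Ideal.span_singleton_one, inf_top_eq, h1]
    refine ⟨Resolution.principal _ h0, Resolution.principal _ h1, Resolution.principal _ h2, ?_⟩
    simp only [Resolution.principal_hasGen, map_zero, degree_single]
    refine ⟨?_, ?_, ?_, ?_, ?_⟩ <;> grind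
  | succ m ih =>
    obtain ⟨A, B, C, hA, hB, hC, hB', hC'⟩ := ih (by omega)
    have hs : vertExponent m ≠ 0 := fun h => by
      have := degree_vertExponent m
      rw [h, map_zero] at this
      omega
    have ht : horizExponent n m ≠ 0 := fun h => by
      have := degree_horizExponent n m
      rw [h, map_zero] at this
      omega
    obtain ⟨D, hD⟩ := B.exists_cone A C inf_le_left inf_le_right hs ht
      (fun p hp q hq => exists_of_vert_mul_eq_horiz_mul hmn hp hq)
      (fun x => mem_dominoIdealIn_add_two)
    obtain ⟨E, hE⟩ := B.exists_cone C C inf_le_left le_rfl hs ht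
      (fun p hp q hq => exists_of_vert_mul_eq_horiz_mul hmn hp hq.2)
      (fun x => mem_inf_add_two hmn)
    rw [degree_vertExponent, degree_horizExponent] at hD hE
    refine ⟨B, D, E, fun i j h => ?_, fun i j h => ?_, fun i j h => ?_,
      (hD _ _).2 (Or.inr (Or.inr ⟨m, 3 * m + 1, hC', rfl, by ring⟩)),
      (hE _ _).2 (Or.inr (Or.inr ⟨m, 3 * m + 1, hC', rfl, by ring⟩))⟩
    · have := hB i j h
      omega
    · rcases (hD i j).1 h with ⟨k, hk, rfl⟩ | ⟨k, hk, rfl⟩ | ⟨l, k, hk, rfl, rfl⟩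
      · have := hB i k hk
        omega
      · have := hA i k hk
        omega
      · have := hC l k hk
        omega
    · rcases (hE i j).1 h with ⟨k, hk, rfl⟩ | ⟨k, hk, rfl⟩ | ⟨l, k, hk, rfl, rfl⟩
      · have := hB i k hk
        omega
      · have := hC i k hk
        omega
      · have := hC l k hk
        omega

end Domino

/-- reg(I_n) = 2n - 1, i.e. in any minimal graded free resolution of the
domino ideal, max{j - i : β_{i,j} ≠ 0} = 2n - 1. -/
theorem reg_domino_ideal (K : Type*) [Field K] :
    ∀ n : ℕ, 1 ≤ n →
      ∀ F : MinimalFreeResolution (dominoIdeal K n),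
        (∀ i j : ℕ, F.β i j ≠ 0 → (j : ℤ) - i ≤ 2 * n - 1) ∧
        ∃ i j : ℕ, F.β i j ≠ 0 ∧ (j : ℤ) - i = 2 * n - 1 := by
  intro n hn F
  obtain ⟨m, rfl⟩ := Nat.exists_eq_add_of_le' hn
  obtain ⟨-, B, -, -, hB, -, hB', -⟩ := Domino.exists_resolutions K (m + 1) m le_rfl
  constructor
  · intro i j h
    have := hB i j ((F.hasGen_toResolution.2 h).of_hasGen B)
    push_cast
    omega
  · refine ⟨m, 3 * m + 1, F.hasGen_toResolution.1 (hB'.of_hasGen F.toResolution), ?_⟩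
    push_cast
    ring
end
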